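/- arXiv:1911.05910 — 2 statements merged into one kernel-verified Lean document; each statement's English description precedes it below -/
import Mathlib

section
/- Let M = 1. Then for every real x > 1, the set 𝒰(x) contains an isolated point; that is, (1, ∞) ⊆ X_iso. -/
open scoped ENNReal NNReal Classical

namespace Expansions

/-- Digit sequences over the alphabet `{0,1,…,M}`; index `i : ℕ` represents the
`(i+1)`-st digit `d_{i+1}` of the paper. -/
abbrev Digits (M : ℕ) := ℕ → Fin (M + 1)

/-- `π_q((d_i)) = Σ_{i≥1} d_i / q^i`. -/
noncomputable def piQ (M : ℕ) (q : ℝ) (d : Digits M) : ℝ :=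
  ∑' i : ℕ, (d i : ℝ) / q ^ (i + 1)

/-- `𝒰_q` : the set of real numbers having a unique `q`-expansion. -/
def Uq (M : ℕ) (q : ℝ) : Set ℝ := {x | ∃! d : Digits M, piQ M q d = x}

/-- `𝐔_q` : the set of sequences that are the unique `q`-expansion of their value. -/
def UqSym (M : ℕ) (q : ℝ) : Set (Digits M) :=
  {d | ∀ e : Digits M, piQ M q e = piQ M q d → e = d}

/-- `𝒰(x)` : the set of univoque bases of `x`. -/
def Ubases (M : ℕ) (x : ℝ) : Set ℝ :=
  {q | q ∈ Set.Ioc (1 : ℝ) ((M : ℝ) + 1) ∧ x ∈ Uq M q}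

/-- `q_x = min{M+1, 1+M/x}`. -/
noncomputable def qx (M : ℕ) (x : ℝ) : ℝ := min ((M : ℝ) + 1) (1 + (M : ℝ) / x)

/-- Strict lexicographic order on digit sequences. -/
def lexLt {M : ℕ} (c d : Digits M) : Prop := ∃ n, (∀ i < n, c i = d i) ∧ c n < d n

def lexLe {M : ℕ} (c d : Digits M) : Prop := c = d ∨ lexLt c d

/-- The sequence ends with `0^∞`. -/
def EndsInZero {M : ℕ} (d : Digits M) : Prop := ∃ N, ∀ n ≥ N, d n = 0

/-- `d` is the quasi-greedy `q`-expansion of `x`: the lexicographically largest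
`q`-expansion of `x` not ending with `0^∞`. -/
def IsQuasiGreedy (M : ℕ) (q x : ℝ) (d : Digits M) : Prop :=
  piQ M q d = x ∧ ¬ EndsInZero d ∧
    ∀ e : Digits M, piQ M q e = x → ¬ EndsInZero e → lexLe e d

/-- `Φ_x(q)`: the quasi-greedy `q`-expansion of `x` (junk value if none exists). -/
noncomputable def Phi (M : ℕ) (x q : ℝ) : Digits M :=
  if h : ∃ d : Digits M, IsQuasiGreedy M q x d then h.choose else fun _ => 0

/-- `𝐔(x) = {Φ_x(q) : q ∈ 𝒰(x)}`. -/
def UxSym (M : ℕ) (x : ℝ) : Set (Digits M) := (Phi M x) '' (Ubases M x)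

/-- `ρ((c_i),(d_i)) = (M+1)^{-inf{i ≥ 1 : c_i ≠ d_i}}` (our index `n` represents the
`(n+1)`-st digit, whence the exponent `-(n+1)`); `ρ(c,c) = 0`. -/
noncomputable def rho (M : ℕ) (c d : Digits M) : ℝ :=
  if c = d then 0
  else ((M : ℝ) + 1) ^ (-(((sInf {i | c i ≠ d i} : ℕ) : ℤ) + 1))

/-- Diameter of a set with respect to a distance function, valued in `ℝ≥0∞`. -/
noncomputable def gdiam {X : Type*} (dist : X → X → ℝ) (A : Set X) : ℝ≥0∞ :=
  ⨆ x ∈ A, ⨆ y ∈ A, ENNReal.ofReal (dist x y)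

/-- The `s`-dimensional Hausdorff outer measure with respect to a distance function:
`lim_{δ→0⁺} inf {Σ diam(C n)^s : A ⊆ ⋃ C n, diam (C n) ≤ δ}`. -/
noncomputable def gHMeasure {X : Type*} (dist : X → X → ℝ) (s : ℝ) (A : Set X) : ℝ≥0∞ :=
  ⨆ (δ : ℝ) (_ : 0 < δ),
    ⨅ (C : ℕ → Set X) (_ : A ⊆ ⋃ n, C n)
      (_ : ∀ n, gdiam dist (C n) ≤ ENNReal.ofReal δ),
      ∑' n, gdiam dist (C n) ^ s

/-- Hausdorff dimension with respect to a distance function. -/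
noncomputable def gdimH {X : Type*} (dist : X → X → ℝ) (A : Set X) : ℝ≥0∞ :=
  ⨆ (s : ℝ≥0) (_ : gHMeasure dist (s : ℝ) A = ⊤), (s : ℝ≥0∞)

/-- The generalized golden ratio `q_G`. -/
noncomputable def qG (M : ℕ) : ℝ :=
  if M % 2 = 0 then ((M / 2 : ℕ) : ℝ) + 1
  else (((M / 2 : ℕ) : ℝ) + 1 +
    Real.sqrt (((M / 2 : ℕ) : ℝ) ^ 2 + 6 * ((M / 2 : ℕ) : ℝ) + 5)) / 2

/-- `x_G = M/(q_G - 1)`. -/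
noncomputable def xG (M : ℕ) : ℝ := (M : ℝ) / (qG M - 1)

/-- The Komornik–Loreti constant `q_KL = min 𝒰(1)`. -/
noncomputable def qKL (M : ℕ) : ℝ := sInf (Ubases M 1)

/-- `x_KL = M/(q_KL - 1)`. -/
noncomputable def xKL (M : ℕ) : ℝ := (M : ℝ) / (qKL M - 1)

/-- `X_iso`: the set of `x > 0` such that `𝒰(x)` contains an isolated point. -/
def Xiso (M : ℕ) : Set ℝ :=
  {x | 0 < x ∧ ∃ q ∈ Ubases M x, ∃ ε > 0, Ubases M x ∩ Set.Ioo (q - ε) (q + ε) = {q}}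

/-- The bifurcation set `𝒱 = {q ∈ (1,M+1] : 𝐔_r ≠ 𝐔_q for all r > q}`. -/
def Vset (M : ℕ) : Set ℝ :=
  {q | q ∈ Set.Ioc (1 : ℝ) ((M : ℝ) + 1) ∧
    ∀ r ∈ Set.Ioc (1 : ℝ) ((M : ℝ) + 1), q < r → UqSym M r ≠ UqSym M q}

/-- The Thue–Morse sequence `τ_i` = parity of the binary digit sum of `i`. -/
def tm (i : ℕ) : ℕ := (Nat.digits 2 i).sum % 2

/-! ### Binary sequences and their values -/

/-- The real number `0` or `1` encoded by a Boolean digit. -/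
def digit (a : Bool) : ℝ := bif a then 1 else 0

/-- The value `Σ b_i / q^(i+1)` of a binary sequence in base `q`. -/
noncomputable def binVal (q : ℝ) (b : ℕ → Bool) : ℝ := ∑' i : ℕ, digit (b i) / q ^ (i + 1)

/-- The sequence obtained by deleting the first `k` digits. -/
def shift (k : ℕ) (b : ℕ → Bool) : ℕ → Bool := fun i => b (i + k)

/-- The reflection of a binary sequence. -/
def reflect (b : ℕ → Bool) : ℕ → Bool := fun i => !b i

@[simp] lemma digit_true : digit true = 1 := rfl
@[simp] lemma digit_false : digit false = 0 := rfl

lemma digit_nonneg (a : Bool) : 0 ≤ digit a := by cases a <;> simp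

lemma digit_le_one (a : Bool) : digit a ≤ 1 := by cases a <;> simp

lemma digit_not (a : Bool) : digit (!a) = 1 - digit a := by cases a <;> simp

@[simp] lemma shift_shift (j k : ℕ) (b : ℕ → Bool) : shift j (shift k b) = shift (j + k) b := by
  funext i; simp [shift, add_assoc]

@[simp] lemma shift_zero (b : ℕ → Bool) : shift 0 b = b := rfl

@[simp] lemma reflect_reflect (b : ℕ → Bool) : reflect (reflect b) = b := by
  funext i; simp [reflect]

lemma shift_reflect (k : ℕ) (b : ℕ → Bool) : shift k (reflect b) = reflect (shift k b) := rfl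

lemma hasSum_one_div_pow {q : ℝ} (hq : 1 < q) :
    HasSum (fun i : ℕ => 1 / q ^ (i + 1)) (1 / (q - 1)) := by
  have h := (hasSum_geometric_of_lt_one (r := q⁻¹) (by positivity) (inv_lt_one_of_one_lt₀ hq)).mul_left
    q⁻¹
  have h0 : q ≠ 0 := by positivity
  have h1 : q - 1 ≠ 0 := by linarith
  have e : (fun i : ℕ => 1 / q ^ (i + 1)) = fun i : ℕ => q⁻¹ * q⁻¹ ^ i := by
    funext i
    rw [one_div, ← inv_pow, pow_succ, mul_comm]
  rw [e, show 1 / (q - 1) = q⁻¹ * (1 - q⁻¹)⁻¹ by field_simp]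
  exact h

lemma summable_binVal {q : ℝ} (hq : 1 < q) (b : ℕ → Bool) :
    Summable (fun i : ℕ => digit (b i) / q ^ (i + 1)) := by
  have h0 : 0 < q := by positivity
  refine Summable.of_nonneg_of_le (fun i => ?_) (fun i => ?_) (hasSum_one_div_pow hq).summable
  · have := digit_nonneg (b i); positivity
  · have := digit_le_one (b i); gcongr

lemma binVal_nonneg {q : ℝ} (hq : 1 < q) (b : ℕ → Bool) : 0 ≤ binVal q b := by
  have h0 : 0 < q := by positivity
  exact tsum_nonneg fun i => div_nonneg (digit_nonneg _) (by positivity)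

lemma binVal_reflect {q : ℝ} (hq : 1 < q) (b : ℕ → Bool) :
    binVal q (reflect b) = 1 / (q - 1) - binVal q b := by
  rw [← (hasSum_one_div_pow hq).tsum_eq, binVal, binVal,
    ← (hasSum_one_div_pow hq).summable.tsum_sub (summable_binVal hq b)]
  congr 1; funext i
  rw [reflect, digit_not, sub_div]

lemma binVal_le {q : ℝ} (hq : 1 < q) (b : ℕ → Bool) : binVal q b ≤ 1 / (q - 1) := by
  have := binVal_nonneg hq (reflect b)
  rw [binVal_reflect hq] at this
  linarith

lemma binVal_false (q : ℝ) : binVal q (fun _ => false) = 0 := by simp [binVal]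

lemma binVal_true {q : ℝ} (hq : 1 < q) : binVal q (fun _ => true) = 1 / (q - 1) := by
  simpa [binVal] using (hasSum_one_div_pow hq).tsum_eq

lemma binVal_eq_head_add {q : ℝ} (hq : 1 < q) (b : ℕ → Bool) :
    binVal q b = (digit (b 0) + binVal q (shift 1 b)) / q := by
  rw [binVal, (summable_binVal hq b).tsum_eq_zero_add, binVal, add_div, ← tsum_div_const]
  simp [shift, pow_succ, div_div]

lemma binVal_shift {q : ℝ} (hq : 1 < q) (k : ℕ) (b : ℕ → Bool) :
    binVal q (shift k b) = (digit (b k) + binVal q (shift (k + 1) b)) / q := by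
  rw [binVal_eq_head_add hq, shift_shift, add_comm 1 k]; simp [shift]

lemma binVal_sub_of_prefix {q : ℝ} (hq : 1 < q) {n : ℕ} {b c : ℕ → Bool}
    (h : ∀ i < n, b i = c i) :
    binVal q b - binVal q c = (binVal q (shift n b) - binVal q (shift n c)) / q ^ n := by
  have h0 : q ≠ 0 := by positivity
  induction n with
  | zero => simp
  | succ n ih =>
    rw [ih fun i hi => h i (by omega), binVal_shift hq, binVal_shift hq n c, h n (by omega)]
    field_simp
    ring

lemma binVal_strictAnti {q r : ℝ} (hq : 1 < q) (hr : q < r) {b : ℕ → Bool}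
    (hb : ∃ i, b i = true) : binVal r b < binVal q b := by
  obtain ⟨i, hi⟩ := hb
  have h0 : 0 < q := by positivity
  refine Summable.tsum_lt_tsum (i := i) (fun j => ?_) ?_ (summable_binVal (hq.trans hr) b)
    (summable_binVal hq b)
  · have := digit_nonneg (b j)
    dsimp only
    gcongr
  · simp only [hi, digit_true]
    gcongr

lemma binVal_anti {q r : ℝ} (hq : 1 < q) (hr : q ≤ r) (b : ℕ → Bool) :
    binVal r b ≤ binVal q b := by
  have h0 : 0 < q := by positivity
  refine Summable.tsum_le_tsum (fun j => ?_) (summable_binVal (hq.trans_le hr) b)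
    (summable_binVal hq b)
  have := digit_nonneg (b j)
  gcongr

lemma continuousOn_binVal {a c : ℝ} (ha : 1 < a) (b : ℕ → Bool) :
    ContinuousOn (fun q => binVal q b) (Set.Icc a c) := by
  have h0 : 0 < a := by positivity
  refine continuousOn_tsum (fun i => ?_) (hasSum_one_div_pow ha).summable (fun i q hq => ?_)
  · refine ContinuousOn.div continuousOn_const (by fun_prop) fun q hq => ?_
    have : 0 < q := h0.trans_le hq.1
    positivity
  · have hq0 : 0 < q := h0.trans_le hq.1
    have h1 := digit_nonneg (b i)
    have h2 := digit_le_one (b i)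
    rw [Real.norm_of_nonneg (by positivity)]
    have := hq.1
    gcongr

lemma exists_binVal_eq {q y : ℝ} (hq : 1 < q) (hq2 : q ≤ 2) (hy0 : 0 ≤ y)
    (hy : y ≤ 1 / (q - 1)) : ∃ b, binVal q b = y := by
  have h0 : 0 < q := by positivity
  have h1 : 0 < q - 1 := by linarith
  let a : ℝ → Bool := fun r => decide (1 ≤ r * q)
  let R : ℕ → ℝ := fun n => Nat.rec y (fun _ r => r * q - digit (a r)) n
  have hR : ∀ n, R (n + 1) = R n * q - digit (a (R n)) := fun n => rfl
  have hmem : ∀ n, 0 ≤ R n ∧ R n ≤ 1 / (q - 1) := by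
    intro n
    induction n with
    | zero => exact ⟨hy0, hy⟩
    | succ n ih =>
      rw [hR]
      by_cases h : 1 ≤ R n * q
      · simp only [a, h, decide_true, digit_true]
        refine ⟨by linarith, ?_⟩
        have : R n * q ≤ 1 / (q - 1) * q := by gcongr; exact ih.2
        have e : 1 / (q - 1) * q - 1 = 1 / (q - 1) := by field_simp; ring
        linarith
      · simp only [a, h, decide_false, digit_false]
        have h3 : (1 : ℝ) ≤ 1 / (q - 1) := by rw [le_div_iff₀ h1]; linarith
        have := ih.1
        exact ⟨by simp; positivity, by linarith⟩
  refine ⟨fun n => a (R n), ?_⟩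
  have key : ∀ n, ∑ i ∈ Finset.range n, digit (a (R i)) / q ^ (i + 1) = y - R n / q ^ n := by
    intro n
    induction n with
    | zero => simp [R]
    | succ n ih => rw [Finset.sum_range_succ, ih, hR]; field_simp; ring
  have hlim : Filter.Tendsto (fun n => y - R n / q ^ n) Filter.atTop (nhds (y - 0)) := by
    refine Filter.Tendsto.sub tendsto_const_nhds ?_
    refine squeeze_zero (fun n => div_nonneg (hmem n).1 (by positivity))
      (fun n => (by gcongr; exact (hmem n).2 : R n / q ^ n ≤ 1 / (q - 1) / q ^ n)) ?_
    exact tendsto_const_nhds.div_atTop (tendsto_pow_atTop_atTop_of_one_lt hq)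
  have h2 := (summable_binVal hq fun n => a (R n)).hasSum.tendsto_sum_nat
  simp_rw [key] at h2
  simpa [binVal] using tendsto_nhds_unique h2 hlim

/-! ### Univoque sequences -/

/-- The inequalities characterising the sequences that are the only expansion of their value. -/
def IsUnivoque (q : ℝ) (b : ℕ → Bool) : Prop :=
  ∀ k, (b k = false → binVal q (shift (k + 1) b) < 1) ∧
    (b k = true → binVal q (reflect (shift (k + 1) b)) < 1)

lemma IsUnivoque.reflect {q : ℝ} {b : ℕ → Bool} (h : IsUnivoque q b) :
    IsUnivoque q (reflect b) := by
  intro k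
  rw [shift_reflect, reflect_reflect]
  simpa [Expansions.reflect, and_comm] using h k

lemma exists_first_ne {b c : ℕ → Bool} (h : b ≠ c) : ∃ n, (∀ i < n, b i = c i) ∧ b n ≠ c n := by
  have h' : ∃ n, b n ≠ c n := by
    by_contra! hn
    exact h (funext hn)
  exact ⟨Nat.find h', fun i hi => by simpa using Nat.find_min h' hi, Nat.find_spec h'⟩

lemma IsUnivoque.eq_of_binVal_eq {q : ℝ} (hq : 1 < q) {b c : ℕ → Bool} (h : IsUnivoque q b)
    (he : binVal q c = binVal q b) : c = b := by
  have h0 : 0 < q := by positivity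
  by_contra hne
  obtain ⟨n, hn, hd⟩ := exists_first_ne hne
  have h1 := binVal_sub_of_prefix hq hn
  rw [he, sub_self, eq_comm, div_eq_zero_iff, or_iff_left (by positivity), binVal_shift hq,
    binVal_shift hq n b, ← sub_div, div_eq_zero_iff, or_iff_left (by positivity)] at h1
  have h2 := binVal_nonneg hq (shift (n + 1) c)
  have h3 := binVal_le hq (shift (n + 1) c)
  have h4 := h n
  rw [binVal_reflect hq] at h4
  cases hb : b n <;> cases hc : c n <;> simp_all <;> linarith

lemma lt_one_of_unique {q : ℝ} (hq : 1 < q) (hq2 : q ≤ 2) {b : ℕ → Bool}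
    (h : ∀ c, binVal q c = binVal q b → c = b) {k : ℕ} (hk : b k = false) :
    binVal q (shift (k + 1) b) < 1 := by
  have h0 : q ≠ 0 := by positivity
  by_contra! hlt
  obtain ⟨e, he⟩ := exists_binVal_eq hq hq2 (y := binVal q (shift (k + 1) b) - 1) (by linarith)
    (by linarith [binVal_le hq (shift (k + 1) b)])
  let c : ℕ → Bool := fun i => if i < k then b i else if i = k then true else e (i - (k + 1))
  have hc1 : shift (k + 1) c = e := by
    funext i
    have h1 : ¬ i + (k + 1) < k := by omega
    have h2 : i + (k + 1) ≠ k := by omega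
    simp [shift, c, h1, h2]
  have hck : c k = true := by simp [c]
  have hpre := binVal_sub_of_prefix hq (n := k) (b := c) (c := b)
    (fun i hi => by simp [c, hi])
  rw [binVal_shift hq, binVal_shift hq k b, hc1, hck, hk, he] at hpre
  simp only [digit_true, digit_false, zero_add, add_sub_cancel, sub_self, zero_div,
    sub_eq_zero] at hpre
  have := congrFun (h c hpre) k
  simp [hck, hk] at this

lemma isUnivoque_of_unique {q : ℝ} (hq : 1 < q) (hq2 : q ≤ 2) {b : ℕ → Bool}
    (h : ∀ c, binVal q c = binVal q b → c = b) : IsUnivoque q b := by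
  refine fun k => ⟨lt_one_of_unique hq hq2 h, fun hk => ?_⟩
  rw [← shift_reflect]
  refine lt_one_of_unique hq hq2 (fun c hc => ?_) (by simp [reflect, hk])
  rw [← reflect_reflect c, h (reflect c)]
  rw [binVal_reflect hq, hc, binVal_reflect hq]
  ring

open Filter Topology in
/-- An expansion in a base near `r` of a number whose `r`-expansion is unique shares a long prefix
with that expansion. -/
lemma IsUnivoque.eventually_prefix {r : ℝ} (hr : 1 < r) {b : ℕ → Bool} (h : IsUnivoque r b)
    (m : ℕ) : ∀ᶠ q in 𝓝 r, ∀ c, binVal q c = binVal r b → ∀ i < m, c i = b i := by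
  let Y : ℕ → ℝ → ℝ := fun n q => Nat.rec (binVal r b) (fun k y => q * y - digit (b k)) n
  have hY : ∀ n q, Y (n + 1) q = q * Y n q - digit (b n) := fun n q => rfl
  have hYc : ∀ n, Continuous (Y n) := by
    intro n
    induction n with
    | zero => exact continuous_const
    | succ n ih =>
      have : Y (n + 1) = fun q => q * Y n q - digit (b n) := rfl
      rw [this]
      fun_prop
  have hYr : ∀ n, Y n r = binVal r (shift n b) := by
    intro n
    induction n with
    | zero => rfl
    | succ n ih =>
      have h0 : r ≠ 0 := by positivity
      rw [hY, ih, binVal_shift hr]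
      field_simp
      ring
  have hstep : ∀ {q : ℝ}, 1 < q → ∀ {c : ℕ → Bool}, binVal q c = binVal r b → ∀ n,
      (∀ i < n, c i = b i) → binVal q (shift n c) = Y n q := by
    intro q hq c hc n
    have h0 : q ≠ 0 := by positivity
    induction n with
    | zero => exact fun _ => hc
    | succ n ih =>
      intro hi
      have := ih fun i hin => hi i (by omega)
      rw [hY, ← this, binVal_shift hq n, hi n (by omega)]
      field_simp
      ring
  induction m with
  | zero => simp
  | succ m ih =>
    have h1 : ∀ᶠ q in 𝓝 r, 1 < q := eventually_gt_nhds hr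
    have key : ∀ᶠ q in 𝓝 r, (b m = false → q * Y m q < 1) ∧
        (b m = true → 1 < (q * Y m q) * (q - 1)) := by
      have hm := h m
      have h0 : r ≠ 0 := by positivity
      have e : r * Y m r = digit (b m) + binVal r (shift (m + 1) b) := by
        rw [hYr, binVal_shift hr]
        field_simp
      cases hb : b m
      · have hlt : r * Y m r < 1 := by rw [e, hb]; simpa using hm.1 hb
        have hc : Continuous fun q => q * Y m q := continuous_id.mul (hYc m)
        filter_upwards [hc.continuousAt.eventually (eventually_lt_nhds hlt)] with q h
        exact ⟨fun _ => h, by simp⟩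
      · have hlt : 1 < (r * Y m r) * (r - 1) := by
          have h2 := hm.2 hb
          rw [binVal_reflect hr, sub_lt_iff_lt_add, div_lt_iff₀ (by linarith)] at h2
          rw [e, hb]
          simpa using h2
        have hc : Continuous fun q => (q * Y m q) * (q - 1) :=
          (continuous_id.mul (hYc m)).mul (by fun_prop)
        filter_upwards [hc.continuousAt.eventually (eventually_gt_nhds hlt)] with q h
        exact ⟨by simp, fun _ => h⟩
    filter_upwards [ih, h1, key] with q hih hq hkey c hc i hi
    have hpre := hih c hc
    rcases Nat.lt_succ_iff_lt_or_eq.mp hi with hlt | rfl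
    · exact hpre i hlt
    have h0 : q ≠ 0 := by positivity
    have e : q * Y i q = digit (c i) + binVal q (shift (i + 1) c) := by
      rw [← hstep hq hc i hpre, binVal_shift hq]
      field_simp
    have h2 := binVal_nonneg hq (shift (i + 1) c)
    have h3 := binVal_le hq (shift (i + 1) c)
    rw [le_div_iff₀ (by linarith)] at h3
    rw [e] at hkey
    clear e hpre ih hstep hYr hY
    cases hb : b i <;> cases hcc : c i
    · rfl
    · have := hkey.1 hb
      rw [hcc, digit_true] at this
      linarith
    · have := hkey.2 hb
      rw [hcc, digit_false, zero_add] at this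
      linarith
    · rfl

/-! ### Lexicographic order and values -/

/-- Strict lexicographic order on binary sequences. -/
def Lex (b c : ℕ → Bool) : Prop := ∃ n, (∀ i < n, b i = c i) ∧ b n = false ∧ c n = true

lemma Lex.trichotomy (b c : ℕ → Bool) : Lex b c ∨ b = c ∨ Lex c b := by
  by_cases h : b = c
  · exact Or.inr (Or.inl h)
  obtain ⟨n, hn, hd⟩ := exists_first_ne h
  cases hb : b n <;> cases hc : c n
  · simp_all
  · exact Or.inl ⟨n, hn, hb, hc⟩
  · exact Or.inr (Or.inr ⟨n, fun i hi => (hn i hi).symm, hc, hb⟩)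
  · simp_all

lemma Lex.irrefl (b : ℕ → Bool) : ¬ Lex b b := by
  rintro ⟨n, -, h, h'⟩
  simp_all

lemma Lex.asymm {b c : ℕ → Bool} (h : Lex b c) : ¬ Lex c b := by
  rintro ⟨m, hm, h1, h2⟩
  obtain ⟨n, hn, h3, h4⟩ := h
  rcases lt_trichotomy m n with hlt | rfl | hlt
  · have := hn m hlt; simp_all
  · simp_all
  · have := hm n hlt; simp_all

lemma lex_shift_one_iff {b c : ℕ → Bool} (h : b 0 = c 0) :
    Lex (shift 1 b) (shift 1 c) ↔ Lex b c := by
  constructor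
  · rintro ⟨n, hn, h1, h2⟩
    refine ⟨n + 1, fun i hi => ?_, h1, h2⟩
    rcases i with _ | i
    · exact h
    · exact hn i (by omega)
  · rintro ⟨n, hn, h1, h2⟩
    rcases n with _ | n
    · simp_all
    · exact ⟨n, fun i hi => hn (i + 1) (by omega), h1, h2⟩

/-- If every tail following a digit `0` is lexicographically at most `a`, then the value is at
most that of `a`, provided the latter is at most one. -/
lemma binVal_le_of_not_lex {q : ℝ} (hq : 1 < q) {a d : ℕ → Bool} (ha : binVal q a ≤ 1)
    (hd : ¬ Lex a d) (ht : ∀ k, d k = false → ¬ Lex a (shift (k + 1) d)) :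
    binVal q d ≤ binVal q a := by
  have h0 : 0 < q := by positivity
  have key : ∀ n : ℕ, ∀ d : ℕ → Bool, ¬ Lex a d →
      (∀ k, d k = false → ¬ Lex a (shift (k + 1) d)) →
      binVal q d ≤ binVal q a + 1 / (q - 1) / q ^ n := by
    intro n
    induction n with
    | zero =>
      intro d _ _
      have := binVal_le hq d
      have := binVal_nonneg hq a
      simp only [pow_zero, div_one]
      linarith
    | succ n ih =>
      intro d hd ht
      have hpos : 0 < 1 / (q - 1) := by
        have : 0 < q - 1 := by linarith
        positivity
      rcases Lex.trichotomy a d with h | rfl | ⟨m, hm, h1, h2⟩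
      · exact absurd h hd
      · have : 0 < 1 / (q - 1) / q ^ (n + 1) := by positivity
        linarith
      · have hsub := binVal_sub_of_prefix hq hm
        have htail := ih (shift (m + 1) d) (ht m h1) (fun k hk => by
          rw [shift_shift, show k + 1 + (m + 1) = (k + (m + 1)) + 1 by ring]
          exact ht _ hk)
        have ha' := binVal_nonneg hq (shift (m + 1) a)
        rw [binVal_shift hq, binVal_shift hq m a, h1, h2, digit_true, digit_false, ← sub_div,
          div_div] at hsub
        have h3 : binVal q d - binVal q a ≤ (1 / (q - 1) / q ^ n) / (q * q ^ m) := by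
          rw [hsub]
          gcongr
          linarith
        have h4 : (1 / (q - 1) / q ^ n) / (q * q ^ m) ≤ 1 / (q - 1) / q ^ (n + 1) := by
          rw [div_div (1 / (q - 1)), pow_succ, ← mul_assoc]
          have : 1 ≤ q ^ m := one_le_pow₀ hq.le
          exact div_le_div_of_nonneg_left hpos.le (by positivity)
            (le_mul_of_one_le_right (by positivity) this)
        linarith
  have hlim : Filter.Tendsto (fun n : ℕ => binVal q a + 1 / (q - 1) / q ^ n) Filter.atTop
      (nhds (binVal q a + 0)) :=
    tendsto_const_nhds.add
      (tendsto_const_nhds.div_atTop (tendsto_pow_atTop_atTop_of_one_lt hq))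
  rw [add_zero] at hlim
  exact ge_of_tendsto' hlim fun n => key n d hd ht

/-- If `a` has value one and its tails following a digit `0` are lexicographically at most `a`,
then every sequence above `a` has value at least one. -/
lemma one_le_binVal_of_lex {q : ℝ} (hq : 1 < q) {a d : ℕ → Bool} (ha : binVal q a = 1)
    (ht : ∀ k, a k = false → ¬ Lex a (shift (k + 1) a)) (hd : Lex a d) : 1 ≤ binVal q d := by
  have h0 : 0 < q := by positivity
  obtain ⟨n, hn, h1, h2⟩ := hd
  have hsub := binVal_sub_of_prefix hq hn
  have htail := binVal_le_of_not_lex hq ha.le (ht n h1) (fun k hk => by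
    rw [shift_shift, show k + 1 + (n + 1) = (k + (n + 1)) + 1 by ring]
    exact ht _ hk)
  have h3 := binVal_nonneg hq (shift (n + 1) d)
  rw [binVal_shift hq, binVal_shift hq n d, h1, h2, digit_true, digit_false, ← sub_div,
    div_div] at hsub
  have : binVal q a - binVal q d ≤ 0 := by
    rw [hsub]
    apply div_nonpos_of_nonpos_of_nonneg
    · linarith
    · positivity
  linarith

/-! ### The period-doubling substitution -/

/-- The substitution `0 ↦ 01`, `1 ↦ 10`. -/
def double (b : ℕ → Bool) : ℕ → Bool := fun i => xor (b (i / 2)) (decide (i % 2 = 1))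

lemma double_even (b : ℕ → Bool) (i : ℕ) : double b (2 * i) = b i := by
  simp [double]

lemma double_odd (b : ℕ → Bool) (i : ℕ) : double b (2 * i + 1) = !b i := by
  have h1 : (2 * i + 1) / 2 = i := by omega
  have h2 : (2 * i + 1) % 2 = 1 := by omega
  simp [double, h1, h2]

lemma eq_double_of_even_odd {b c : ℕ → Bool} (h0 : ∀ i, c (2 * i) = b i)
    (h1 : ∀ i, c (2 * i + 1) = !b i) : c = double b := by
  funext i
  rcases Nat.even_or_odd' i with ⟨j, rfl | rfl⟩
  · rw [h0, double_even]
  · rw [h1, double_odd]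

lemma reflect_double (b : ℕ → Bool) : reflect (double b) = double (reflect b) := by
  apply eq_double_of_even_odd <;> intro i <;> simp [reflect, double_even, double_odd]

lemma shift_double (k : ℕ) (b : ℕ → Bool) : shift (2 * k) (double b) = double (shift k b) := by
  apply eq_double_of_even_odd <;> intro i
  · rw [shift, ← mul_add, double_even, shift]
  · rw [shift, show 2 * i + 1 + 2 * k = 2 * (i + k) + 1 by ring, double_odd, shift]

lemma Lex.double {b c : ℕ → Bool} (h : Lex b c) : Lex (double b) (double c) := by
  obtain ⟨n, hn, h1, h2⟩ := h
  refine ⟨2 * n, fun i hi => ?_, by rwa [double_even], by rwa [double_even]⟩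
  rw [Expansions.double, Expansions.double, hn _ (by omega)]

lemma lex_double_iff {b c : ℕ → Bool} : Lex (double b) (double c) ↔ Lex b c := by
  refine ⟨fun h => ?_, Lex.double⟩
  rcases Lex.trichotomy b c with h' | rfl | h'
  · exact h'
  · exact absurd h (Lex.irrefl _)
  · exact absurd h h'.double.asymm

/-- The periodic sequences obtained by iterating the substitution on `0^∞`. -/
def lowSeq : ℕ → ℕ → Bool
  | 0 => fun _ => false
  | n + 1 => double (lowSeq n)

/-- The eventually periodic sequences obtained by iterating the substitution on `01^∞`. -/
def topSeq : ℕ → ℕ → Bool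
  | 0 => fun i => decide (i ≠ 0)
  | n + 1 => double (topSeq n)

lemma lowSeq_zero_eq (n : ℕ) : lowSeq n 0 = false := by
  induction n with
  | zero => rfl
  | succ n ih => exact (double_even _ 0).trans ih

lemma topSeq_zero_eq (n : ℕ) : topSeq n 0 = false := by
  induction n with
  | zero => rfl
  | succ n ih => exact (double_even _ 0).trans ih

lemma lowSeq_succ_one (n : ℕ) : lowSeq (n + 1) 1 = true := by
  have := double_odd (lowSeq n) 0
  rw [lowSeq_zero_eq] at this
  exact this

lemma topSeq_one (n : ℕ) : topSeq n 1 = true := by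
  rcases n with _ | n
  · rfl
  · have := double_odd (topSeq n) 0
    rw [topSeq_zero_eq] at this
    exact this

lemma lowSeq_one_apply (i : ℕ) : lowSeq 1 i = decide (i % 2 = 1) := by
  simp [lowSeq, double]

/-- Every tail of `s` with first digit `0`, and the reflection of every tail with first digit `1`,
is lexicographically at most `a`; the tail starting at index `0` is not considered. -/
def TailsLe (a s : ℕ → Bool) : Prop :=
  ∀ i ≥ 1, (s i = false → ¬ Lex a (shift i s)) ∧ (s i = true → ¬ Lex a (reflect (shift i s)))

lemma TailsLe.reflect {a s : ℕ → Bool} (h : TailsLe a s) : TailsLe a (reflect s) := by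
  intro i hi
  rw [shift_reflect, reflect_reflect]
  simpa [Expansions.reflect, and_comm] using h i hi

lemma not_lex_double {a t : ℕ → Bool} (h0 : a 0 = false) (h1 : a 1 = true) (ht0 : t 0 = false)
    (ht : t 2 = !t 1) : ¬ Lex (double a) t := by
  have e1 : double a 1 = true := by simpa [h0] using double_odd a 0
  have e2 : double a 2 = true := by simpa [h1] using double_even a 1
  rintro ⟨n, hn, h2, h3⟩
  rcases n with _ | _ | _ | n
  · simp_all
  · simp_all
  · simp_all
  · have k1 := hn 1 (by omega)
    have k2 := hn 2 (by omega)
    simp_all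

lemma TailsLe.double {a s : ℕ → Bool} (h0 : a 0 = false) (h1 : a 1 = true) (h : TailsLe a s) :
    TailsLe (double a) (double s) := by
  intro i hi
  rcases Nat.even_or_odd' i with ⟨j, rfl | rfl⟩
  · rw [shift_double, double_even, reflect_double, lex_double_iff, lex_double_iff]
    exact h j (by omega)
  · have e : shift (2 * j + 1) (Expansions.double s) 2 =
        !shift (2 * j + 1) (Expansions.double s) 1 := by
      simp only [shift]
      rw [show 2 + (2 * j + 1) = 2 * (j + 1) + 1 by ring,
        show 1 + (2 * j + 1) = 2 * (j + 1) by ring, double_even, double_odd]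
    exact ⟨fun h2 => not_lex_double h0 h1 (by simpa [shift] using h2) e,
      fun h2 => not_lex_double h0 h1 (by simpa [shift, Expansions.reflect] using h2)
        (by simp only [Expansions.reflect, e])⟩

lemma not_lex_lowSeq_one {t : ℕ → Bool} (h0 : t 0 = false) (h1 : t 1 = false) :
    ¬ Lex (lowSeq 1) t := by
  have e := lowSeq_succ_one 0
  rintro ⟨n, hn, h2, h3⟩
  rcases n with _ | _ | n
  · simp_all
  · simp_all
  · have := hn 1 (by omega)
    simp_all

/-- The sequence `0111(01)^∞`. -/
def bridgeSeq : ℕ → Bool := fun i => decide (i % 2 = 1) || decide (i = 2)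

lemma tailsLe_bridgeSeq : TailsLe (lowSeq 1) bridgeSeq := by
  have hodd : ∀ i ≥ 3, bridgeSeq i = false → shift i bridgeSeq = lowSeq 1 := by
    intro i hi h
    funext j
    have : i % 2 = 0 := by
      simp only [bridgeSeq, Bool.or_eq_false_iff, decide_eq_false_iff_not] at h; omega
    simp only [shift, bridgeSeq, lowSeq_one_apply, show (j + i) % 2 = j % 2 by omega,
      show j + i ≠ 2 by omega, decide_false, Bool.or_false]
  have heven : ∀ i ≥ 3, bridgeSeq i = true → reflect (shift i bridgeSeq) = lowSeq 1 := by
    intro i hi h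
    funext j
    have : i % 2 = 1 := by
      simp only [bridgeSeq, Bool.or_eq_true, decide_eq_true_eq] at h; omega
    simp only [reflect, shift, bridgeSeq, lowSeq_one_apply, show j + i ≠ 2 by omega,
      decide_false, Bool.or_false, ← decide_not, decide_eq_decide]
    omega
  intro i hi
  rcases (by omega : i = 1 ∨ i = 2 ∨ 3 ≤ i) with rfl | rfl | h3
  · exact ⟨by simp [bridgeSeq], fun _ => not_lex_lowSeq_one rfl rfl⟩
  · exact ⟨by simp [bridgeSeq], fun _ => not_lex_lowSeq_one rfl rfl⟩
  · refine ⟨fun h => ?_, fun h => ?_⟩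
    · rw [hodd i h3 h]; exact Lex.irrefl _
    · rw [heven i h3 h]; exact Lex.irrefl _

lemma tailsLe_lowSeq (n : ℕ) : TailsLe (lowSeq (n + 1)) (lowSeq (n + 1)) := by
  induction n with
  | zero =>
    refine fun i _ => ⟨fun h => ?_, fun h => ?_⟩
    · rw [show shift i (lowSeq 1) = lowSeq 1 from ?_]
      · exact Lex.irrefl _
      · funext j
        simp only [zero_add, lowSeq_one_apply, decide_eq_false_iff_not] at h
        simp only [shift, lowSeq_one_apply, show (j + i) % 2 = j % 2 by omega]
    · rw [show reflect (shift i (lowSeq 1)) = lowSeq 1 from ?_]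
      · exact Lex.irrefl _
      · funext j
        simp only [zero_add, lowSeq_one_apply, decide_eq_true_eq] at h
        simp only [reflect, shift, lowSeq_one_apply, ← decide_not, decide_eq_decide]
        omega
  | succ n ih => exact ih.double (lowSeq_zero_eq _) (lowSeq_succ_one _)

lemma topSeq_one_apply (i : ℕ) :
    topSeq 1 i = (decide (2 ≤ i) ^^ decide (i % 2 = 1)) := by
  have : (i / 2 ≠ 0) = (2 ≤ i) := by rw [eq_iff_iff]; omega
  simp only [topSeq, double, this]

lemma tailsLe_topSeq (n : ℕ) : TailsLe (lowSeq (n + 1)) (topSeq (n + 1)) := by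
  induction n with
  | zero =>
    intro i hi
    rcases (by omega : i = 1 ∨ 2 ≤ i) with rfl | h2
    · exact ⟨by simp [topSeq_one], fun _ => not_lex_lowSeq_one rfl rfl⟩
    refine ⟨fun h => ?_, fun h => ?_⟩
    · rw [show shift i (topSeq 1) = lowSeq 1 from ?_]
      · exact Lex.irrefl _
      · funext j
        simp only [zero_add, topSeq_one_apply, h2, decide_true, Bool.true_xor,
          Bool.not_eq_false', decide_eq_true_eq] at h
        simp only [shift, topSeq_one_apply, lowSeq_one_apply, show 2 ≤ j + i by omega,
          decide_true, Bool.true_xor, ← decide_not, decide_eq_decide]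
        omega
    · rw [show reflect (shift i (topSeq 1)) = lowSeq 1 from ?_]
      · exact Lex.irrefl _
      · funext j
        simp only [zero_add, topSeq_one_apply, h2, decide_true, Bool.true_xor,
          Bool.not_eq_true', decide_eq_false_iff_not] at h
        simp only [reflect, shift, topSeq_one_apply, lowSeq_one_apply, show 2 ≤ j + i by omega,
          decide_true, Bool.true_xor, Bool.not_not, decide_eq_decide]
        omega
  | succ n ih => exact ih.double (lowSeq_zero_eq _) (lowSeq_succ_one _)

lemma TailsLe.not_lex_shift {a s : ℕ → Bool} (h0 : a 0 = false) (h : TailsLe a s) {i : ℕ}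
    (hi : 1 ≤ i) (hs : s i = false) : ¬ Lex (shift 1 a) (shift (i + 1) s) := by
  rw [add_comm i 1, ← shift_shift, lex_shift_one_iff (by simpa [shift, h0] using hs.symm)]
  exact (h i hi).1 hs

lemma TailsLe.binVal_le {q : ℝ} (hq : 1 < q) {a s : ℕ → Bool} (h0 : a 0 = false)
    (ha : binVal q (shift 1 a) ≤ 1) (h : TailsLe a s) {i : ℕ} (hi : 1 ≤ i) (hs : s i = false) :
    binVal q (shift (i + 1) s) ≤ binVal q (shift 1 a) := by
  refine binVal_le_of_not_lex hq ha (h.not_lex_shift h0 hi hs) fun k hk => ?_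
  rw [shift_shift, show k + 1 + (i + 1) = (k + (i + 1)) + 1 by ring]
  exact h.not_lex_shift h0 (by omega) hk

lemma TailsLe.isUnivoque {q : ℝ} (hq : 1 < q) {a s : ℕ → Bool} (h0 : a 0 = false)
    (ha : binVal q (shift 1 a) < 1) (h : TailsLe a s) : IsUnivoque q (shift 1 s) := by
  intro k
  rw [shift_shift, add_assoc, add_comm 1 1, ← add_assoc]
  refine ⟨fun hk => (h.binVal_le hq h0 ha.le (i := k + 1) (by omega) hk).trans_lt ha,
    fun hk => ?_⟩
  rw [← shift_reflect]
  refine (h.reflect.binVal_le hq h0 ha.le (i := k + 1) (by omega) ?_).trans_lt ha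
  simpa [Expansions.reflect, shift] using hk

/-- Every tail of `e` with first digit `0`, and the reflection of every tail with first digit `1`,
is lexicographically less than `a`. -/
def TailsLt (a e : ℕ → Bool) : Prop :=
  ∀ k, (e k = false → Lex (shift k e) a) ∧ (e k = true → Lex (reflect (shift k e)) a)

lemma IsUnivoque.lex_lowSeq {q p : ℝ} (hq : 1 < q) (hqp : q ≤ p) {n : ℕ}
    (hp : binVal p (shift 1 (lowSeq (n + 1))) = 1) {e : ℕ → Bool} (h : IsUnivoque q e) {k : ℕ}
    (hk : e k = false) : Lex (shift k e) (lowSeq (n + 1)) := by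
  have h0 := lowSeq_zero_eq (n + 1)
  have hlt := (h k).1 hk
  have hanti := binVal_anti hq hqp (shift (k + 1) e)
  rcases Lex.trichotomy (shift k e) (lowSeq (n + 1)) with h' | h' | h'
  · exact h'
  · rw [← h', shift_shift, add_comm] at hp
    linarith
  · rw [← lex_shift_one_iff (by simpa [shift, h0] using hk.symm), shift_shift, add_comm 1 k] at h'
    have := one_le_binVal_of_lex (hq.trans_le hqp) hp (fun j hj => by
      rw [shift_shift, add_assoc, add_comm 1 1, ← add_assoc]
      exact (tailsLe_lowSeq n).not_lex_shift h0 (i := j + 1) (by omega) hj) h'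
    linarith

lemma IsUnivoque.tailsLt {q p : ℝ} (hq : 1 < q) (hqp : q ≤ p) {n : ℕ}
    (hp : binVal p (shift 1 (lowSeq (n + 1))) = 1) {e : ℕ → Bool} (h : IsUnivoque q e) :
    TailsLt (lowSeq (n + 1)) e := by
  refine fun k => ⟨h.lex_lowSeq hq hqp hp, fun hk => ?_⟩
  rw [← shift_reflect]
  exact h.reflect.lex_lowSeq hq hqp hp (by simpa [Expansions.reflect] using hk)

/-! ### Sets of confined sequences are scattered -/

lemma Lex.eq_false {t a : ℕ → Bool} (h : Lex t a) {j : ℕ} (hp : ∀ i < j, t i = a i)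
    (hj : a j = false) : t j = false := by
  obtain ⟨n, hn, h1, h2⟩ := h
  rcases lt_trichotomy n j with hlt | rfl | hlt
  · have := hp n hlt; simp_all
  · exact h1
  · rw [hn j hlt, hj]

lemma lowSeq_add_two_prefix (n : ℕ) :
    lowSeq (n + 2) 2 = true ∧ lowSeq (n + 2) 3 = false ∧
      (lowSeq (n + 2) 4 = true → lowSeq (n + 2) 5 = false ∧ lowSeq (n + 2) 6 = false) := by
  have h0 := lowSeq_zero_eq n
  refine ⟨?_, ?_, ?_⟩ <;> simp [lowSeq, double, h0]

lemma Lex.window {t : ℕ → Bool} {n : ℕ} (h : Lex t (lowSeq (n + 2))) (h0 : t 0 = false)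
    (h1 : t 1 = true) (h2 : t 2 = true) :
    t 3 = false ∧ (t 4 = true → t 5 = false ∧ t 6 = false) := by
  have a0 := lowSeq_zero_eq (n + 2)
  have a1 := lowSeq_succ_one (n + 1)
  obtain ⟨a2, a3, a4⟩ := lowSeq_add_two_prefix n
  have b3 : t 3 = false := h.eq_false (fun i hi => by interval_cases i <;> simp_all) a3
  refine ⟨b3, fun b4 => ?_⟩
  have c4 : lowSeq (n + 2) 4 = true := by
    by_contra hc
    rw [Bool.not_eq_true] at hc
    have := h.eq_false (j := 4) (fun i hi => by interval_cases i <;> simp_all) hc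
    simp_all
  obtain ⟨a5, a6⟩ := a4 c4
  have b5 : t 5 = false := h.eq_false (fun i hi => by interval_cases i <;> simp_all) a5
  exact ⟨b5, h.eq_false (fun i hi => by interval_cases i <;> simp_all) a6⟩

lemma TailsLt.window {e : ℕ → Bool} {n : ℕ} (h : TailsLt (lowSeq (n + 2)) e) (k : ℕ)
    (h1 : e (k + 1) = !e k) (h2 : e (k + 2) = !e k) :
    e (k + 3) = e k ∧ (e (k + 4) = (!e k) → e (k + 5) = e k ∧ e (k + 6) = e k) := by
  cases hk : e k
  · have := ((h k).1 hk).window (by simp [shift, hk])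
      (by rw [shift, add_comm, h1, hk]; rfl) (by rw [shift, add_comm, h2, hk]; rfl)
    simpa [shift, add_comm] using this
  · have := ((h k).2 hk).window (by simp [shift, reflect, hk])
      (by rw [reflect, shift, add_comm, h1, hk]; rfl)
      (by rw [reflect, shift, add_comm, h2, hk]; rfl)
    simpa [shift, reflect, add_comm] using this

/-- After a block `abb` a confined sequence is an image of the substitution. -/
lemma TailsLt.exists_eq_double {e : ℕ → Bool} {n : ℕ} (h : TailsLt (lowSeq (n + 1)) e) {k : ℕ}
    (h1 : e (k + 1) = !e k) (h2 : e (k + 2) = !e k) :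
    ∃ f, shift k e = double f ∧ TailsLt (lowSeq n) f := by
  obtain _ | n := n
  · exfalso
    cases hk : e k
    · have := ((h k).1 hk).eq_false (j := 2) (fun i hi => by
        interval_cases i
        · rw [lowSeq_zero_eq]; simpa [shift] using hk
        · rw [lowSeq_succ_one, shift, add_comm, h1, hk]; rfl) (by simp [lowSeq, double])
      rw [shift, add_comm, h2, hk] at this
      simp at this
    · have := ((h k).2 hk).eq_false (j := 2) (fun i hi => by
        interval_cases i
        · rw [lowSeq_zero_eq]; simpa [shift, reflect] using hk
        · rw [lowSeq_succ_one, reflect, shift, add_comm, h1, hk]; rfl) (by simp [lowSeq, double])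
      rw [reflect, shift, add_comm, h2, hk] at this
      simp at this
  have K := h.window
  have key : ∀ i : ℕ, ∃ p, p = k + 2 * i ∧
      ((e (p + 1) = (!e p) ∧ e (p + 2) = (!e p) ∧ e (p + 3) = e p) ∨
       (e (p + 1) = (!e p) ∧ e (p + 2) = e p ∧ e (p + 3) = (!e p) ∧
        ∃ r, p = r + 2 ∧ e r = (!e p) ∧ e (r + 1) = e p)) := by
    intro i
    induction i with
    | zero => exact ⟨k, by simp, Or.inl ⟨h1, h2, (K k h1 h2).1⟩⟩
    | succ i ih =>
      obtain ⟨p, hp, ⟨g1, g2, g3⟩ | ⟨g1, g2, g3, r, rfl, g4, g5⟩⟩ := ih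
      · refine ⟨p + 2, by omega, ?_⟩
        have k1 := K p g1 g2
        have k2 := K (p + 2)
        simp only [add_assoc, Nat.reduceAdd] at k1 k2 ⊢
        by_cases g4 : e (p + 4) = !e p
        · right
          obtain ⟨g5, -⟩ := k1.2 g4
          exact ⟨by simp_all, by simp_all, by simp_all, p, rfl, by simp_all, by simp_all⟩
        · left
          have g4' : e (p + 4) = e p := by
            revert g4; cases e (p + 4) <;> cases e p <;> simp
          have := (k2 (by simp_all) (by simp_all)).1
          exact ⟨by simp_all, by simp_all, this⟩
      · refine ⟨r + 4, by omega, Or.inl ?_⟩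
        have k1 := K r
        have k2 := K (r + 4)
        simp only [add_assoc, Nat.reduceAdd] at k1 k2 g1 g2 g3 ⊢
        have k3 := ((k1 (by simp_all) (by simp_all)).2 (by simp_all)).2
        have k4 := (k2 (by simp_all) (by simp_all)).1
        exact ⟨by simp_all, by simp_all, k4⟩
  have hd : shift k e = double fun i => e (k + 2 * i) := by
    refine eq_double_of_even_odd (fun i => by rw [shift, add_comm]) fun i => ?_
    obtain ⟨p, rfl, hp⟩ := key i
    have : e (k + 2 * i + 1) = !e (k + 2 * i) := by
      rcases hp with hp | hp <;> exact hp.1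
    rw [shift, show 2 * i + 1 + k = k + 2 * i + 1 by ring, this]
  refine ⟨_, hd, fun i => ?_⟩
  have e1 : shift (k + 2 * i) e = double (shift i fun i => e (k + 2 * i)) := by
    rw [← shift_double, ← hd, shift_shift, add_comm]
  have := h (k + 2 * i)
  rw [e1, reflect_double, lowSeq, lex_double_iff, lex_double_iff] at this
  exact this

lemma exists_isolated_of_tailsLt (n : ℕ) (A : Set (ℕ → Bool)) (hne : A.Nonempty)
    (hA : ∀ e ∈ A, TailsLt (lowSeq n) e) :
    ∃ d ∈ A, ∃ m : ℕ, ∀ e ∈ A, (∀ i < m, e i = d i) → e = d := by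
  induction n generalizing A with
  | zero =>
    obtain ⟨e, he⟩ := hne
    exfalso
    have h := hA e he 0
    cases h0 : e 0
    · obtain ⟨n, -, -, h3⟩ := h.1 h0
      simp [lowSeq] at h3
    · obtain ⟨n, -, -, h3⟩ := h.2 h0
      simp [lowSeq] at h3
  | succ n ih =>
    by_cases hpat : ∃ e ∈ A, ∃ k, e (k + 1) = (!e k) ∧ e (k + 2) = !e k
    · obtain ⟨e₀, he₀, k, h1, h2⟩ := hpat
      let B : Set (ℕ → Bool) := {f | TailsLt (lowSeq n) f ∧
        ∃ e ∈ A, (∀ i < k + 3, e i = e₀ i) ∧ shift k e = double f}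
      have hB : ∀ e ∈ A, (∀ i < k + 3, e i = e₀ i) → ∃ f ∈ B, shift k e = double f := by
        intro e he hpre
        obtain ⟨f, hf, hf'⟩ := (hA e he).exists_eq_double (k := k)
          (by rw [hpre _ (by omega), hpre _ (by omega), h1])
          (by rw [hpre _ (by omega), hpre _ (by omega), h2])
        exact ⟨f, ⟨hf', e, he, hpre, hf⟩, hf⟩
      obtain ⟨f₀, hf₀, -⟩ := hB e₀ he₀ fun _ _ => rfl
      obtain ⟨f, ⟨-, d, hd, hpre, hdf⟩, m, hm⟩ := ih B ⟨f₀, hf₀⟩ fun f hf => hf.1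
      refine ⟨d, hd, k + 3 + 2 * m, fun e he hi => ?_⟩
      obtain ⟨g, hg, heg⟩ := hB e he fun i hik => (hi i (by omega)).trans (hpre i hik)
      have hgf : g = f := hm g hg fun i him => by
        rw [← double_even g, ← double_even f, ← heg, ← hdf, shift, shift, hi _ (by omega)]
      funext i
      rcases lt_or_ge i k with hik | hik
      · exact hi i (by omega)
      · have := congrFun (heg.trans (hgf ▸ hdf.symm)) (i - k)
        simpa [shift, Nat.sub_add_cancel hik] using this
    · push Not at hpat
      by_cases hch : ∃ e ∈ A, ∃ k, e (k + 1) = !e k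
      · obtain ⟨d, hd, k, hk⟩ := hch
        refine ⟨d, hd, k + 2, fun e he hi => ?_⟩
        have halt : ∀ e ∈ A, e (k + 1) = (!e k) → ∀ j, e (k + j + 1) = !e (k + j) := by
          intro e he hk j
          induction j with
          | zero => exact hk
          | succ j ih =>
            have := hpat e he (k + j) ih
            rw [← add_assoc, ih]
            simpa using this
        have h1 := halt d hd hk
        have h2 := halt e he (by rw [hi _ (by omega), hi _ (by omega), hk])
        have h3 : ∀ j, e (k + j) = d (k + j) := by
          intro j
          induction j with
          | zero => exact hi _ (by omega)
          | succ j ih => rw [← add_assoc, h1, h2, ih]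
        funext i
        rcases lt_or_ge i k with hik | hik
        · exact hi i (by omega)
        · rw [← Nat.add_sub_cancel' hik, h3]
      · push Not at hch
        have hconst : ∀ e ∈ A, ∀ i, e i = e 0 := by
          intro e he i
          induction i with
          | zero => rfl
          | succ i ih => simpa [ih] using hch e he i
        obtain ⟨d, hd⟩ := hne
        refine ⟨d, hd, 1, fun e he hi => ?_⟩
        funext i
        rw [hconst e he, hconst d hd, hi 0 (by omega)]

/-! ### Closed forms for the values of the substitutive sequences -/

lemma binVal_double {q : ℝ} (hq : 1 < q) (b : ℕ → Bool) :
    binVal q (double b) = (q - 1) * binVal (q ^ 2) b + 1 / (q ^ 2 - 1) := by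
  have h0 : q ≠ 0 := by positivity
  have hq2 : 1 < q ^ 2 := one_lt_pow₀ hq two_ne_zero
  have hs := (summable_binVal hq2 b).hasSum
  have h1 : HasSum (fun k => digit (double b (2 * k)) / q ^ (2 * k + 1))
      (q * binVal (q ^ 2) b) := by
    refine (hs.mul_left q).congr_fun fun k => ?_
    rw [double_even]
    field_simp
    ring
  have h2 : HasSum (fun k => digit (double b (2 * k + 1)) / q ^ (2 * k + 1 + 1))
      (1 / (q ^ 2 - 1) - binVal (q ^ 2) b) := by
    refine ((hasSum_one_div_pow hq2).sub hs).congr_fun fun k => ?_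
    rw [double_odd, digit_not, ← sub_div, ← pow_mul]
    ring
  have h3 := (HasSum.even_add_odd (f := fun i => digit (double b i) / q ^ (i + 1)) h1 h2).tsum_eq
  rw [binVal, h3]
  ring

/-- The product `∏_{j < n} (1 - q^(-2^j))`. -/
noncomputable def doublingProd : ℕ → ℝ → ℝ
  | 0, _ => 1
  | n + 1, q => (1 - 1 / q) * doublingProd n (q ^ 2)

lemma doublingProd_succ (n : ℕ) (q : ℝ) :
    doublingProd (n + 1) q = doublingProd n q * (1 - 1 / q ^ 2 ^ n) := by
  induction n generalizing q with
  | zero => simp [doublingProd]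
  | succ n ih =>
    rw [doublingProd, ih, doublingProd, ← pow_mul, ← pow_succ']
    ring

lemma doublingProd_pos (n : ℕ) {q : ℝ} (hq : 1 < q) : 0 < doublingProd n q := by
  induction n generalizing q with
  | zero => simp [doublingProd]
  | succ n ih =>
    have : 1 / q < 1 := by rw [div_lt_one (by positivity)]; exact hq
    exact mul_pos (by linarith) (ih (one_lt_pow₀ hq two_ne_zero))

/-- The value of the periodic sequence obtained from `lowSeq n` by deleting its first digit. -/
noncomputable def lowVal (n : ℕ) (q : ℝ) : ℝ := binVal q (shift 1 (lowSeq n))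

/-- The value of the sequence obtained from `topSeq n` by deleting its first digit. -/
noncomputable def topVal (n : ℕ) (q : ℝ) : ℝ := binVal q (shift 1 (topSeq n))

lemma binVal_shift_one {q : ℝ} (hq : 1 < q) {b : ℕ → Bool} (h : b 0 = false) :
    binVal q (shift 1 b) = q * binVal q b := by
  have h0 : q ≠ 0 := by positivity
  rw [binVal_eq_head_add hq b, h, digit_false, zero_add]
  field_simp

lemma lowVal_eq (n : ℕ) {q : ℝ} (hq : 1 < q) :
    lowVal n q = (q / (q - 1) - doublingProd n q * (q ^ 2 ^ n / (q ^ 2 ^ n - 1))) / 2 := by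
  rw [lowVal, binVal_shift_one hq (lowSeq_zero_eq n)]
  induction n generalizing q with
  | zero => simp [lowSeq, doublingProd, binVal_false]
  | succ n ih =>
    have hq2 : 1 < q ^ 2 := one_lt_pow₀ hq two_ne_zero
    have h0 : q ≠ 0 := by positivity
    have h1 : q - 1 ≠ 0 := by linarith
    have h2 : q + 1 ≠ 0 := by linarith
    have h := ih hq2
    rw [← pow_mul, ← pow_succ'] at h
    rw [lowSeq, binVal_double hq, doublingProd]
    generalize q ^ 2 ^ (n + 1) / (q ^ 2 ^ (n + 1) - 1) = Z at h ⊢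
    have h3 : binVal (q ^ 2) (lowSeq n) =
        (q ^ 2 / (q ^ 2 - 1) - doublingProd n (q ^ 2) * Z) / 2 / q ^ 2 := by
      rw [← h]; field_simp
    rw [h3, show q ^ 2 - 1 = (q - 1) * (q + 1) by ring]
    field_simp
    ring

lemma topVal_eq (n : ℕ) {q : ℝ} (hq : 1 < q) :
    topVal n q = lowVal n q + doublingProd n q / (q ^ 2 ^ n - 1) := by
  rw [topVal, lowVal, binVal_shift_one hq (lowSeq_zero_eq n), binVal_shift_one hq (topSeq_zero_eq n)]
  induction n generalizing q with
  | zero =>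
    have : shift 1 (topSeq 0) = fun _ => true := by funext i; simp [shift, topSeq]
    rw [← binVal_shift_one hq (topSeq_zero_eq 0), this, binVal_true hq]
    simp [lowSeq, doublingProd, binVal_false]
  | succ n ih =>
    have h0 : q ≠ 0 := by positivity
    have h := ih (one_lt_pow₀ hq two_ne_zero)
    rw [← pow_mul, ← pow_succ'] at h
    rw [lowSeq, topSeq, binVal_double hq, binVal_double hq, doublingProd]
    have h3 : binVal (q ^ 2) (topSeq n) = binVal (q ^ 2) (lowSeq n) +
        doublingProd n (q ^ 2) / (q ^ 2 ^ (n + 1) - 1) / q ^ 2 := by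
      rw [eq_comm, ← sub_eq_zero]
      field_simp
      linarith
    rw [h3]
    field_simp
    ring

lemma lowVal_succ_sub (n : ℕ) {q : ℝ} (hq : 1 < q) :
    0 < lowVal (n + 1) q - lowVal n q := by
  rw [lowVal_eq _ hq, lowVal_eq _ hq, doublingProd_succ, pow_succ 2 n, pow_mul]
  have hP := doublingProd_pos n hq
  have hQ : 1 < q ^ 2 ^ n := one_lt_pow₀ hq (by positivity)
  generalize q ^ 2 ^ n = Q at *
  have h1 : 0 < Q - 1 := by linarith
  have e : (q / (q - 1) - doublingProd n q * (1 - 1 / Q) * (Q ^ 2 / (Q ^ 2 - 1))) / 2 -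
      (q / (q - 1) - doublingProd n q * (Q / (Q - 1))) / 2 =
      doublingProd n q * (Q / ((Q - 1) * (Q + 1))) := by
    rw [show Q ^ 2 - 1 = (Q - 1) * (Q + 1) by ring]
    field_simp
    ring
  rw [e]
  positivity

lemma topVal_succ_of_lowVal_succ_eq_one {n : ℕ} {q : ℝ} (hq : 1 < q)
    (h : lowVal (n + 1) q = 1) :
    topVal (n + 1) q = 1 + (1 / (q - 1) - 1) / (q ^ 2 ^ n) ^ 2 := by
  rw [topVal_eq _ hq, h]
  rw [lowVal_eq _ hq] at h
  rw [pow_succ 2 n, pow_mul] at *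
  have hQ : 1 < q ^ 2 ^ n := one_lt_pow₀ hq (by positivity)
  generalize q ^ 2 ^ n = Q at *
  have h1 : Q ^ 2 - 1 ≠ 0 := by nlinarith
  have h2 : q - 1 ≠ 0 := by linarith
  have e : q / (q - 1) = 1 + 1 / (q - 1) := by field_simp; ring
  have h3 : 1 / (q - 1) - 1 = doublingProd (n + 1) q * (Q ^ 2 / (Q ^ 2 - 1)) := by linarith
  rw [h3]
  field_simp

lemma topVal_of_lowVal_add_two_eq_one {n : ℕ} {q : ℝ} (hq : 1 < q)
    (h : lowVal (n + 2) q = 1) :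
    topVal n q = 1 + (1 / (q - 1) - 1) / (q ^ 2 ^ n * (q ^ 2 ^ n - 1) ^ 2) := by
  have hQ : 1 < q ^ 2 ^ n := one_lt_pow₀ hq (by positivity)
  rw [lowVal_eq _ hq, doublingProd_succ, doublingProd_succ] at h
  rw [topVal_eq _ hq, lowVal_eq _ hq]
  have e1 : q ^ 2 ^ (n + 1) = (q ^ 2 ^ n) ^ 2 := by rw [← pow_mul, pow_succ]
  have e2 : q ^ 2 ^ (n + 2) = (q ^ 2 ^ n) ^ 4 := by rw [← pow_mul, pow_add]; norm_num
  rw [e1, e2] at h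
  generalize q ^ 2 ^ n = Q at *
  generalize doublingProd n q = P at *
  have h1 : Q - 1 ≠ 0 := by linarith
  have h2 : Q + 1 ≠ 0 := by linarith
  have h3 : Q ^ 2 + 1 ≠ 0 := by positivity
  have h4 : q - 1 ≠ 0 := by linarith
  have e : q / (q - 1) = 1 + 1 / (q - 1) := by field_simp; ring
  rw [e] at h ⊢
  generalize 1 / (q - 1) = t at *
  have h5 : t = 1 + P * (1 - 1 / Q) * (1 - 1 / Q ^ 2) * (Q ^ 4 / (Q ^ 4 - 1)) := by linarith
  rw [h5, show Q ^ 4 - 1 = (Q - 1) * (Q + 1) * (Q ^ 2 + 1) by ring]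
  field_simp
  ring

lemma topVal_lt_topVal_succ {n : ℕ} {q r : ℝ} (hq : 1 < q) (hqr : q < r) (hr : r ≤ 2)
    (hr2 : 7 / 4 ≤ r) (hn : 1 ≤ n) (h1 : lowVal (n + 1) q = 1) (h2 : lowVal (n + 2) r = 1) :
    topVal n r < topVal (n + 1) q := by
  rw [topVal_of_lowVal_add_two_eq_one (hq.trans hqr) h2, topVal_succ_of_lowVal_succ_eq_one hq h1]
  have hQR : q ^ 2 ^ n ≤ r ^ 2 ^ n := by gcongr
  have hQ : 1 < q ^ 2 ^ n := one_lt_pow₀ hq (by positivity)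
  have hR : 3 ≤ r ^ 2 ^ n := by
    calc (3 : ℝ) ≤ r ^ 2 := by nlinarith
      _ ≤ r ^ 2 ^ n := pow_le_pow_right₀ (by linarith) (by
          calc 2 = 2 ^ 1 := rfl
            _ ≤ 2 ^ n := Nat.pow_le_pow_right (by norm_num) hn)
  have hq1 : 0 < q - 1 := by linarith
  have ht : 1 / (r - 1) < 1 / (q - 1) := by gcongr
  have ht0 : 1 ≤ 1 / (r - 1) := by rw [le_div_iff₀ (by linarith)]; linarith
  have hd : (q ^ 2 ^ n) ^ 2 ≤ r ^ 2 ^ n * (r ^ 2 ^ n - 1) ^ 2 := by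
    generalize q ^ 2 ^ n = Q at *
    generalize r ^ 2 ^ n = R at *
    have : R ≤ (R - 1) ^ 2 := by nlinarith
    nlinarith
  have hn0 : 0 ≤ 1 / (r - 1) - 1 := by linarith
  calc 1 + (1 / (r - 1) - 1) / (r ^ 2 ^ n * (r ^ 2 ^ n - 1) ^ 2)
      ≤ 1 + (1 / (r - 1) - 1) / (q ^ 2 ^ n) ^ 2 := by gcongr
    _ < 1 + (1 / (q - 1) - 1) / (q ^ 2 ^ n) ^ 2 := by gcongr

/-! ### The bases at which the periodic sequences have value one -/

lemma exists_low_digit (n : ℕ) : ∃ i, shift 1 (lowSeq (n + 1)) i = true :=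
  ⟨0, lowSeq_succ_one n⟩

lemma lowVal_succ_strictAnti (n : ℕ) {q r : ℝ} (hq : 1 < q) (hr : q < r) :
    lowVal (n + 1) r < lowVal (n + 1) q :=
  binVal_strictAnti hq hr (exists_low_digit n)

lemma exists_lowVal_eq_one (n : ℕ) : ∃ q : ℝ, 1 < q ∧ q < 2 ∧ lowVal (n + 1) q = 1 := by
  have hlow : ∀ n, 1 ≤ lowVal (n + 1) (3 / 2) := by
    intro n
    induction n with
    | zero => rw [lowVal_eq _ (by norm_num)]; norm_num [doublingProd]
    | succ n ih => linarith [lowVal_succ_sub (n + 1) (q := 3 / 2) (by norm_num)]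
  have hhigh : lowVal (n + 1) 2 < 1 := by
    rw [lowVal_eq _ (by norm_num)]
    have h1 := doublingProd_pos (n + 1) (q := 2) (by norm_num)
    have h2 : (1 : ℝ) < 2 ^ 2 ^ (n + 1) := one_lt_pow₀ (by norm_num) (by positivity)
    have h3 : (0 : ℝ) < 2 ^ 2 ^ (n + 1) - 1 := by linarith
    have : 0 < doublingProd (n + 1) 2 * ((2 : ℝ) ^ 2 ^ (n + 1) / (2 ^ 2 ^ (n + 1) - 1)) := by
      positivity
    linarith
  obtain ⟨q, hq, hq1⟩ := intermediate_value_Icc' (by norm_num : (3 / 2 : ℝ) ≤ 2)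
    (continuousOn_binVal (by norm_num) (shift 1 (lowSeq (n + 1)))) ⟨hhigh.le, hlow n⟩
  refine ⟨q, by linarith [hq.1], lt_of_le_of_ne hq.2 ?_, hq1⟩
  rintro rfl
  exact hhigh.ne hq1

lemma exists_isUnivoque_of_tailsLe {n : ℕ} {p r x : ℝ} {s : ℕ → Bool} (hp1 : 1 < p)
    (hpr : p < r) (hp : lowVal (n + 1) p = 1) (hs : TailsLe (lowSeq (n + 1)) s)
    (h1 : x < binVal p (shift 1 s)) (h2 : binVal r (shift 1 s) < x) :
    ∃ q, 1 < q ∧ q < r ∧ ∃ b, IsUnivoque q b ∧ binVal q b = x := by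
  obtain ⟨q, hq, hqx⟩ := intermediate_value_Icc' hpr.le
    (continuousOn_binVal hp1 (shift 1 s)) ⟨h2.le, h1.le⟩
  have hpq : p < q := lt_of_le_of_ne hq.1 (by rintro rfl; exact h1.ne hqx.symm)
  have hqr : q < r := lt_of_le_of_ne hq.2 (by rintro rfl; exact h2.ne hqx)
  refine ⟨q, hp1.trans hpq, hqr, shift 1 s, hs.isUnivoque (hp1.trans hpq) (lowSeq_zero_eq _) ?_,
    hqx⟩
  rw [← hp]
  exact lowVal_succ_strictAnti n hp1 hpq

lemma binVal_bridgeSeq {q : ℝ} (hq : 1 < q) :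
    binVal q (shift 1 bridgeSeq) = (1 + (1 + lowVal 1 q) / q) / q := by
  have e : shift 3 bridgeSeq = shift 1 (lowSeq 1) := by
    funext i
    simp only [shift, bridgeSeq, lowSeq_one_apply]
    simp only [show i + 3 ≠ 2 by omega, decide_false, Bool.or_false, decide_eq_decide]
    omega
  have h1 : bridgeSeq 1 = true := rfl
  have h2 : bridgeSeq 2 = true := rfl
  rw [binVal_shift hq, binVal_shift hq, e, h1, h2, digit_true, lowVal]

lemma exists_isUnivoque_of_one_lt {x : ℝ} (hx : 1 < x) :
    ∃ (n : ℕ) (p : ℝ), 1 < p ∧ p < 2 ∧ lowVal (n + 1) p = 1 ∧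
      ∃ q, 1 < q ∧ q < p ∧ ∃ b, IsUnivoque q b ∧ binVal q b = x := by
  choose p hp1 hp2 hp using exists_lowVal_eq_one
  have hmono : StrictMono p := by
    refine strictMono_nat_of_lt_succ fun n => ?_
    by_contra! h
    have h1 : lowVal (n + 2) (p n) ≤ lowVal (n + 2) (p (n + 1)) :=
      binVal_anti (hp1 _) h _
    linarith [lowVal_succ_sub (n + 1) (hp1 n), hp n, hp (n + 1)]
  have hp0 : p 0 ≤ 81 / 50 := by
    by_contra! h
    have h1 := lowVal_succ_strictAnti 0 (by norm_num) h
    rw [hp, lowVal_eq _ (by norm_num)] at h1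
    norm_num [doublingProd] at h1
  have hp75 : 7 / 4 ≤ p 1 := by
    by_contra! h
    have h1 := lowVal_succ_strictAnti 1 (hp1 1) h
    rw [hp, lowVal_eq _ (by norm_num)] at h1
    norm_num [doublingProd] at h1
  by_cases hA : 1 / (p 1 - 1) < x
  · have hx0 : 0 < x := by linarith
    refine ⟨1, p 1, hp1 1, hp2 1, hp 1, 1 + 1 / x, ?_, ?_, fun _ => true, ?_, ?_⟩
    · have : 0 < 1 / x := by positivity
      linarith
    · have h1 : 0 < p 1 - 1 := by linarith
      have : 1 / x < p 1 - 1 := by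
        rw [div_lt_iff₀ hx0]
        rwa [div_lt_iff₀ h1, mul_comm] at hA
      linarith
    · intro k
      have : reflect (shift (k + 1) fun _ => true) = fun _ => false := rfl
      rw [this, binVal_false]
      simp
    · have : 0 < 1 / x := by positivity
      rw [binVal_true (by linarith)]
      simp
  have hx43 : x ≤ 4 / 3 := by
    refine (not_lt.mp hA).trans ?_
    rw [div_le_iff₀ (by linarith)]
    linarith
  by_cases hB : binVal (p 1) (shift 1 bridgeSeq) < x
  · refine ⟨1, p 1, hp1 1, hp2 1, hp 1, exists_isUnivoque_of_tailsLe (hp1 0)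
      (hmono zero_lt_one) (hp 0) tailsLe_bridgeSeq ?_ hB⟩
    refine lt_of_lt_of_le ?_ (binVal_anti (hp1 0) hp0 _)
    refine lt_of_le_of_lt hx43 ?_
    rw [binVal_bridgeSeq (by norm_num), lowVal_eq _ (by norm_num)]
    norm_num [doublingProd]
  have hx118 : x ≤ 6 / 5 := by
    refine (not_lt.mp hB).trans ((binVal_anti (by norm_num) hp75 _).trans ?_)
    rw [binVal_bridgeSeq (by norm_num), lowVal_eq _ (by norm_num)]
    norm_num [doublingProd]
  have hex : ∃ m, topVal (m + 1) (p (m + 2)) < x := by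
    obtain ⟨m, hm⟩ := exists_pow_lt_of_lt_one (sub_pos.mpr hx) (by norm_num : (4 / 7 : ℝ) < 1)
    refine ⟨m, ?_⟩
    have hpm : 7 / 4 ≤ p (m + 2) := hp75.trans (hmono.monotone (by omega))
    rw [topVal_of_lowVal_add_two_eq_one (hp1 _) (hp _)]
    generalize p (m + 2) = r at hpm
    have hR : (7 / 4 : ℝ) ^ m ≤ r ^ 2 ^ (m + 1) := by
      calc (7 / 4 : ℝ) ^ m ≤ r ^ m := by gcongr
        _ ≤ r ^ 2 ^ (m + 1) := pow_le_pow_right₀ (by linarith)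
            ((Nat.lt_two_pow_self).le.trans (Nat.pow_le_pow_right (by norm_num) (by omega)))
    have hR2 : 2 ≤ r ^ 2 ^ (m + 1) := by
      calc (2 : ℝ) ≤ r ^ 2 := by nlinarith
        _ ≤ r ^ 2 ^ (m + 1) := pow_le_pow_right₀ (by linarith)
            (by rw [pow_succ]; have := Nat.one_le_two_pow (n := m); omega)
    have ht : 1 / (r - 1) - 1 ≤ 1 := by
      rw [sub_le_iff_le_add, div_le_iff₀ (by linarith)]; linarith
    have h74 : (0 : ℝ) < (7 / 4) ^ m := by positivity
    generalize r ^ 2 ^ (m + 1) = R at hR hR2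
    have : (1 / (r - 1) - 1) / (R * (R - 1) ^ 2) ≤ (4 / 7) ^ m := by
      rw [show (4 / 7 : ℝ) = (7 / 4)⁻¹ by norm_num, inv_pow, ← one_div]
      have : (7 / 4 : ℝ) ^ m ≤ R * (R - 1) ^ 2 := by nlinarith
      gcongr
    linarith
  classical
  let m := Nat.find hex
  have hm : topVal (m + 1) (p (m + 2)) < x := Nat.find_spec hex
  refine ⟨m + 2, p (m + 2), hp1 _, hp2 _, hp _, exists_isUnivoque_of_tailsLe (hp1 m)
    (hmono (by omega)) (hp m) (tailsLe_topSeq m) ?_ hm⟩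
  change x < topVal (m + 1) (p m)
  rcases hm0 : m with _ | k
  · refine lt_of_le_of_lt hx118 (lt_of_lt_of_le ?_ (binVal_anti (hp1 0) hp0 _))
    change _ < topVal 1 (81 / 50)
    rw [topVal_eq _ (by norm_num), lowVal_eq _ (by norm_num)]
    norm_num [doublingProd]
  · have hk : x ≤ topVal (k + 1) (p (k + 2)) := not_lt.mp (Nat.find_min hex (by omega))
    exact hk.trans_lt (topVal_lt_topVal_succ (hp1 _) (hmono (Nat.lt_succ_self _)) (hp2 _).le
      (hp75.trans (hmono.monotone (by omega))) (by omega) (hp _) (hp _))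

/-! ### Transfer to the digits of the statement -/

/-- The sequence over the alphabet `{0, 1}` corresponding to a Boolean sequence. -/
def toDigits (b : ℕ → Bool) : Digits 1 := fun i => bif b i then 1 else 0

lemma toDigits_injective : Function.Injective toDigits := by
  intro b c h
  funext i
  have := congrFun h i
  revert this
  cases hb : b i <;> cases hc : c i <;> simp [toDigits, hb, hc]

lemma toDigits_surjective : Function.Surjective toDigits := by
  intro d
  refine ⟨fun i => decide (d i = 1), funext fun i => ?_⟩
  have : ∀ a : Fin (1 + 1), (bif decide (a = 1) then (1 : Fin (1 + 1)) else 0) = a := by decide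
  exact this (d i)

lemma piQ_toDigits (q : ℝ) (b : ℕ → Bool) : piQ 1 q (toDigits b) = binVal q b := by
  refine tsum_congr fun i => ?_
  cases hb : b i <;> simp [toDigits, hb]

lemma mem_Ubases_one_iff {x q : ℝ} :
    q ∈ Ubases 1 x ↔ 1 < q ∧ q ≤ 2 ∧ ∃ b, IsUnivoque q b ∧ binVal q b = x := by
  have h2 : ((1 : ℕ) : ℝ) + 1 = 2 := by norm_num
  simp only [Ubases, Uq, Set.mem_ofPred_eq, Set.mem_Ioc, h2, and_assoc]
  refine and_congr_right fun hq => and_congr_right fun hq2 => ⟨?_, ?_⟩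
  · rintro ⟨d, hd, hu⟩
    obtain ⟨b, rfl⟩ := toDigits_surjective d
    rw [piQ_toDigits] at hd
    refine ⟨b, isUnivoque_of_unique hq hq2 fun c hc => toDigits_injective (hu _ ?_), hd⟩
    exact (piQ_toDigits q c).trans (hc.trans hd)
  · rintro ⟨b, hb, hx⟩
    refine ⟨toDigits b, (piQ_toDigits q b).trans hx, fun d hd => ?_⟩
    obtain ⟨c, rfl⟩ := toDigits_surjective d
    rw [hb.eq_of_binVal_eq hq ((piQ_toDigits q c).symm.trans (hd.trans hx.symm))]

lemma base_eq_of_binVal_eq {x : ℝ} (hx : 0 < x) {b : ℕ → Bool} {q r : ℝ} (hq : 1 < q) (hr : 1 < r)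
    (hqx : binVal q b = x) (hrx : binVal r b = x) : q = r := by
  have hb : ∃ i, b i = true := by
    by_contra! h
    have : b = fun _ => false := funext fun i => by simpa using h i
    rw [this, binVal_false] at hqx
    exact hx.ne hqx
  rcases lt_trichotomy q r with h | h | h
  · linarith [binVal_strictAnti hq h hb]
  · exact h
  · linarith [binVal_strictAnti hr h hb]

lemma exists_isolated_base {x : ℝ} (hx : 1 < x) :
    ∃ q ∈ Ubases 1 x, ∃ ε > 0, Ubases 1 x ∩ Set.Ioo (q - ε) (q + ε) = {q} := by
  obtain ⟨n, p, hp1, hp2, hp, q₀, hq₀, hq₀p, b₀, hb₀, hx₀⟩ := exists_isUnivoque_of_one_lt hx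
  obtain ⟨d, ⟨r, hr, hrp, hd, hdx⟩, m, hm⟩ := exists_isolated_of_tailsLt (n + 1)
    {b | ∃ q, 1 < q ∧ q < p ∧ IsUnivoque q b ∧ binVal q b = x} ⟨b₀, q₀, hq₀, hq₀p, hb₀, hx₀⟩
    (by
      rintro e ⟨q, hq, hqp, he, -⟩
      exact he.tailsLt hq hqp.le hp)
  have hev := (hd.eventually_prefix hr m).and ((lt_mem_nhds hr).and (gt_mem_nhds hrp))
  obtain ⟨ε, hε, hball⟩ := Metric.eventually_nhds_iff_ball.mp hev
  have hrU : r ∈ Ubases 1 x := mem_Ubases_one_iff.mpr ⟨hr, (hrp.trans hp2).le, d, hd, hdx⟩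
  refine ⟨r, hrU, ε, hε, Set.eq_singleton_iff_unique_mem.mpr
    ⟨⟨hrU, by linarith, by linarith⟩, ?_⟩⟩
  rintro q ⟨hqU, hqε⟩
  obtain ⟨hq, -, b, hb, hbx⟩ := mem_Ubases_one_iff.mp hqU
  obtain ⟨hpre, -, hqp⟩ := hball q (by rwa [Real.ball_eq_Ioo])
  have hbd : b = d := hm b ⟨q, hq, hqp, hb, hbx⟩ (hpre b (hbx.trans hdx.symm))
  rw [hbd] at hbx
  exact base_eq_of_binVal_eq (by linarith) hq hr hbx hdx

/-- Let `M = 1`. For every `x > 1` the set `𝒰(x)` contains an isolated point;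
that is, `(1,∞) ⊆ X_iso`. -/
theorem Ubases_isolated_of_one_lt :
    (∀ x : ℝ, 1 < x →
      ∃ q ∈ Ubases 1 x, ∃ ε > 0, Ubases 1 x ∩ Set.Ioo (q - ε) (q + ε) = {q}) ∧
    Set.Ioi (1 : ℝ) ⊆ Xiso 1 := by
  exact ⟨fun x hx => exists_isolated_base hx,
    fun x hx => ⟨zero_lt_one.trans hx, exists_isolated_base hx⟩⟩

end Expansions
end

section
/- Let x ∈ (0,1) and let (ε_i) = Φ_x(M+1) be the quasi-greedy expansion of x in base M+1. Then there exist a finite word w over {0,1,…,M}, a positive integer N, and a strictly increasing sequence (N_j)_{j≥1} of positive integers such that for every j ≥ 1 and every sequence (d_i) ∈ {0,1,…,M}^ℕ satisfying d_{n+1}…d_{n+N_j} ∉ {0^{N_j}, M^{N_j}} for all n ≥ 0 (i.e. (d_i) contains no block of N_j consecutive 0's and no block of N_j consecutive M's), the sequence ε₁…ε_{N+N_j} w d₁ d₂ … belongs to 𝐔(x). -/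
open scoped ENNReal NNReal Classical

namespace Expansions

/-- The sequence obtained by writing the finite word `pre` followed by the sequence `d`. -/
def concatSeq {M : ℕ} (pre : List (Fin (M + 1))) (d : Digits M) : Digits M :=
  fun i => if h : i < pre.length then pre.get ⟨i, h⟩ else d (i - pre.length)

section UnivoqueBases

variable {M : ℕ}

lemma digit_le (a : Fin (M + 1)) : (a : ℝ) ≤ M := by
  exact_mod_cast Nat.lt_succ_iff.mp a.2

lemma hasSum_geometric_digits {q : ℝ} (hq : 1 < q) (m : ℝ) :
    HasSum (fun i : ℕ => m / q ^ (i + 1)) (m / (q - 1)) := by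
  have h0 : 0 < q := by linarith
  have h := (hasSum_geometric_of_lt_one (inv_nonneg.mpr h0.le) (inv_lt_one_of_one_lt₀ hq)).mul_left
    (m / q)
  have e1 : (fun i : ℕ => m / q * q⁻¹ ^ i) = fun i : ℕ => m / q ^ (i + 1) := by
    funext i
    rw [inv_pow, pow_succ]
    field_simp
  have e2 : m / q * (1 - q⁻¹)⁻¹ = m / (q - 1) := by
    have : q - 1 ≠ 0 := by linarith
    field_simp
  rwa [e1, e2] at h

lemma summable_digits {q : ℝ} (hq : 1 < q) (d : Digits M) :
    Summable (fun i : ℕ => (d i : ℝ) / q ^ (i + 1)) := by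
  have h0 : 0 < q := by linarith
  refine Summable.of_nonneg_of_le (fun i => by positivity) (fun i => ?_)
    (hasSum_geometric_digits hq (M : ℝ)).summable
  have := digit_le (d i)
  gcongr

lemma piQ_split {q : ℝ} (hq : 1 < q) (d : Digits M) (n : ℕ) :
    piQ M q d = ∑ i ∈ Finset.range n, (d i : ℝ) / q ^ (i + 1)
      + piQ M q (fun i => d (i + n)) / q ^ n := by
  have h0 : 0 < q := by linarith
  unfold piQ
  rw [← (summable_digits hq d).sum_add_tsum_nat_add n, ← tsum_div_const]
  congr 2
  funext i
  rw [div_div, ← pow_add]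
  congr 2
  ring

lemma piQ_nonneg {q : ℝ} (hq : 1 < q) (d : Digits M) : 0 ≤ piQ M q d := by
  have h0 : 0 < q := by linarith
  exact tsum_nonneg fun i => by positivity

lemma piQ_rev {q : ℝ} (hq : 1 < q) (d : Digits M) :
    piQ M q (fun i => (d i).rev) = (M : ℝ) / (q - 1) - piQ M q d := by
  have h := (hasSum_geometric_digits hq (M : ℝ)).sub (summable_digits hq d).hasSum
  have e : (fun i : ℕ => (((d i).rev : ℕ) : ℝ) / q ^ (i + 1))
      = fun i : ℕ => (M : ℝ) / q ^ (i + 1) - (d i : ℝ) / q ^ (i + 1) := by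
    funext i
    rw [Fin.val_rev, ← sub_div]
    congr 1
    rw [Nat.cast_sub (by omega)]
    push_cast
    ring
  exact HasSum.tsum_eq (e ▸ h)

lemma piQ_le {q : ℝ} (hq : 1 < q) (d : Digits M) : piQ M q d ≤ (M : ℝ) / (q - 1) := by
  have := piQ_nonneg hq (fun i => (d i).rev)
  rw [piQ_rev hq] at this
  linarith

lemma one_le_digit {a : Fin (M + 1)} (h : a ≠ 0) : (1 : ℝ) ≤ a := by
  have : 1 ≤ (a : ℕ) := Nat.one_le_iff_ne_zero.mpr fun h' => h (Fin.ext h')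
  exact_mod_cast this

lemma le_piQ_of_ne_zero {q : ℝ} (hq : 1 < q) {d : Digits M} {t : ℕ} (h : d t ≠ 0) :
    1 / q ^ (t + 1) ≤ piQ M q d := by
  have h0 : 0 < q := by linarith
  have h1 := one_le_digit h
  calc 1 / q ^ (t + 1) ≤ (d t : ℝ) / q ^ (t + 1) := by gcongr
    _ ≤ piQ M q d := (summable_digits hq d).le_tsum t fun i _ => by positivity

lemma piQ_le_of_ne_last {q : ℝ} (hq : 1 < q) {d : Digits M} {t : ℕ} (h : d t ≠ Fin.last M) :
    piQ M q d ≤ (M : ℝ) / (q - 1) - 1 / q ^ (t + 1) := by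
  have h1 : (fun i => (d i).rev) t ≠ 0 := fun h' => h (by simpa using congrArg Fin.rev h')
  have := le_piQ_of_ne_zero hq (d := fun i => (d i).rev) h1
  rw [piQ_rev hq] at this
  linarith

lemma exists_first_diff {c d : Digits M} (h : c ≠ d) : ∃ n, (∀ i < n, c i = d i) ∧ c n ≠ d n := by
  have h' : ∃ n, c n ≠ d n := Function.ne_iff.mp h
  exact ⟨Nat.find h', fun i hi => not_not.mp (Nat.find_min h' hi), Nat.find_spec h'⟩

/-- If two sequences with equal value first differ at `n`, the difference of the tails is
the opposite of the difference of the digits. -/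
lemma tail_eq_of_first_diff {q : ℝ} (hq : 1 < q) {c d : Digits M} (h : piQ M q c = piQ M q d)
    {n : ℕ} (hn : ∀ i < n, c i = d i) :
    (c n : ℝ) + piQ M q (fun i => c (i + (n + 1)))
      = (d n : ℝ) + piQ M q (fun i => d (i + (n + 1))) := by
  have h0 : 0 < q := by linarith
  rw [piQ_split hq c (n + 1), piQ_split hq d (n + 1), Finset.sum_range_succ,
    Finset.sum_range_succ, Finset.sum_congr rfl fun i hi => by
      rw [hn i (Finset.mem_range.mp hi)], add_assoc, add_assoc, ← add_div, ← add_div] at h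
  have := add_left_cancel h
  exact (div_left_inj' (by positivity)).mp this

lemma add_one_le_of_lt {a b : Fin (M + 1)} (h : a < b) : (a : ℝ) + 1 ≤ b := by
  have : (a : ℕ) + 1 ≤ b := h
  exact_mod_cast this

lemma mem_UqSym_of_tails {q : ℝ} (hq : 1 < q) {s : Digits M}
    (hup : ∀ n, s n ≠ Fin.last M → piQ M q (fun i => s (i + (n + 1))) < 1)
    (hlow : ∀ n, s n ≠ 0 → (M : ℝ) / (q - 1) - piQ M q (fun i => s (i + (n + 1))) < 1) :
    s ∈ UqSym M q := by
  intro e he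
  by_contra hne
  obtain ⟨n, hn, hd⟩ := exists_first_diff hne
  have key := tail_eq_of_first_diff hq he hn
  rcases lt_or_gt_of_ne hd with hlt | hgt
  · have h1 := hlow n (Fin.ne_zero_of_lt hlt)
    have h2 := piQ_le hq (fun i => e (i + (n + 1)))
    have h3 := add_one_le_of_lt hlt
    linarith
  · have h1 := hup n (Fin.ne_last_of_lt hgt)
    have h2 := piQ_nonneg hq (fun i => e (i + (n + 1)))
    have h3 := add_one_le_of_lt hgt
    linarith

lemma mem_UqSym_of_short_runs {q : ℝ} (hq : 1 < q) {s : Digits M} {K : ℕ}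
    (hK : (M : ℝ) / (q - 1) - 1 < 1 / q ^ K)
    (hup : ∀ n, s n ≠ Fin.last M → piQ M q (fun i => s (i + (n + 1))) < 1 ∨
      ∃ t < K, s (t + (n + 1)) ≠ Fin.last M)
    (hlow : ∀ n, s n ≠ 0 → ∃ t < K, s (t + (n + 1)) ≠ 0) :
    s ∈ UqSym M q := by
  have h0 : 0 < q := by linarith
  have hmono : ∀ t < K, 1 / q ^ K ≤ 1 / q ^ (t + 1) := fun t ht =>
    one_div_le_one_div_of_le (by positivity) (pow_le_pow_right₀ hq.le ht)
  refine mem_UqSym_of_tails hq (fun n hn => ?_) (fun n hn => ?_)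
  · rcases hup n hn with h | ⟨t, ht, h⟩
    · exact h
    · have h1 := piQ_le_of_ne_last hq (d := fun i => s (i + (n + 1))) h
      have h2 := hmono t ht
      linarith
  · obtain ⟨t, ht, h⟩ := hlow n hn
    have h1 := le_piQ_of_ne_zero hq (d := fun i => s (i + (n + 1))) h
    have h2 := hmono t ht
    linarith

lemma eq_of_piQ_eq_of_not_endsInZero (hM : 0 < M) {c d : Digits M}
    (h : piQ M ((M : ℝ) + 1) c = piQ M ((M : ℝ) + 1) d)
    (hc : ¬ EndsInZero c) (hd : ¬ EndsInZero d) : c = d := by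
  have hM' : (0 : ℝ) < M := by exact_mod_cast hM
  have hq : (1 : ℝ) < (M : ℝ) + 1 := by linarith
  by_contra hne
  obtain ⟨n, hn, hdn⟩ := exists_first_diff hne
  have aux : ∀ {c d : Digits M}, ¬ EndsInZero d → c n < d n →
      (c n : ℝ) + piQ M ((M : ℝ) + 1) (fun i => c (i + (n + 1)))
      = (d n : ℝ) + piQ M ((M : ℝ) + 1) (fun i => d (i + (n + 1))) → False := by
    intro c d hd hlt key
    simp only [EndsInZero, not_exists, not_forall] at hd
    obtain ⟨t, ht, htd⟩ := hd (n + 1)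
    have h1 := piQ_le hq (fun i => c (i + (n + 1)))
    rw [add_sub_cancel_right, div_self hM'.ne'] at h1
    have h2 := le_piQ_of_ne_zero hq (d := fun i => d (i + (n + 1))) (t := t - (n + 1))
      (by rwa [Nat.sub_add_cancel ht])
    have h3 := add_one_le_of_lt hlt
    have h4 : 0 < 1 / ((M : ℝ) + 1) ^ (t - (n + 1) + 1) := by positivity
    linarith
  have key := tail_eq_of_first_diff hq h hn
  rcases lt_or_gt_of_ne hdn with hlt | hgt
  · exact aux hd hlt key
  · exact aux hc hgt key.symm

/-- Every point of `(0,1)` has an expansion in base `M + 1` not ending in zeros. -/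
lemma exists_expansion (hM : 0 < M) {x : ℝ} (hx : x ∈ Set.Ioo (0 : ℝ) 1) :
    ∃ d : Digits M, piQ M ((M : ℝ) + 1) d = x ∧ ¬ EndsInZero d := by
  have hM' : (0 : ℝ) < M := by exact_mod_cast hM
  set b : ℝ := (M : ℝ) + 1 with hb
  have hq : 1 < b := by linarith
  have hb0 : 0 < b := by linarith
  let z : ℕ → ℤ := fun n => ⌈b ^ n * x⌉ - 1
  have hz1 : ∀ n, (z n : ℝ) < b ^ n * x := fun n => by
    have := Int.ceil_lt_add_one (b ^ n * x)
    simp only [z]; push_cast; linarith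
  have hz2 : ∀ n, b ^ n * x ≤ z n + 1 := fun n => by
    have := Int.le_ceil (b ^ n * x)
    simp only [z]; push_cast; linarith
  have hz0 : z 0 = 0 := by
    have : ⌈x⌉ = 1 := by rw [Int.ceil_eq_iff]; norm_num; exact ⟨hx.1, hx.2.le⟩
    simp [z, this]
  have hlo : ∀ n, 0 ≤ z (n + 1) - (M + 1) * z n := fun n => by
    have h1 := hz1 n
    have h2 := hz2 (n + 1)
    have : ((M + 1) * z n : ℝ) < z (n + 1) + 1 := by
      rw [pow_succ] at h2
      have := mul_lt_mul_of_pos_left h1 hb0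
      rw [← hb]
      nlinarith
    have : (M + 1) * z n < z (n + 1) + 1 := by exact_mod_cast this
    omega
  have hhi : ∀ n, z (n + 1) - (M + 1) * z n ≤ M := fun n => by
    have h1 := hz2 n
    have h2 := hz1 (n + 1)
    have : (z (n + 1) : ℝ) < (M + 1) * (z n + 1) := by
      rw [pow_succ] at h2
      have := mul_le_mul_of_nonneg_left h1 hb0.le
      rw [← hb]
      nlinarith
    have : z (n + 1) < (M + 1) * (z n + 1) := by exact_mod_cast this
    linarith
  let d : Digits M := fun n => ⟨(z (n + 1) - (M + 1) * z n).toNat, by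
    have := hlo n; have := hhi n; omega⟩
  have hd : ∀ n, ((d n : ℕ) : ℝ) = z (n + 1) - b * z n := fun n => by
    have : (((z (n + 1) - (M + 1) * z n).toNat : ℤ) : ℝ) = ((z (n + 1) - (M + 1) * z n : ℤ) : ℝ) := by
      rw [Int.toNat_of_nonneg (hlo n)]
    simp only [d]
    push_cast at this
    rw [this, hb]
  have hsum : ∀ n, ∑ i ∈ Finset.range n, (d i : ℝ) / b ^ (i + 1) = z n / b ^ n := by
    intro n
    induction n with
    | zero => simp [hz0]
    | succ n ih =>
      rw [Finset.sum_range_succ, ih, hd, pow_succ]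
      field_simp
      ring
  have hval : piQ M b d = x := by
    have h1 := (summable_digits hq d).hasSum.tendsto_sum_nat
    refine tendsto_nhds_unique h1 ?_
    have hlim : Filter.Tendsto (fun n : ℕ => x - (b⁻¹) ^ n) Filter.atTop (nhds x) := by
      simpa using (tendsto_pow_atTop_nhds_zero_of_lt_one (inv_nonneg.mpr hb0.le)
        (inv_lt_one_of_one_lt₀ hq)).const_sub x
    refine tendsto_of_tendsto_of_tendsto_of_le_of_le hlim tendsto_const_nhds
      (fun n => ?_) (fun n => ?_)
    · have h2 := hz2 n
      have hp : 0 < b ^ n := by positivity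
      simp only [hsum]
      rw [le_div_iff₀ hp, sub_mul, inv_pow, inv_mul_cancel₀ hp.ne']
      linarith
    · have h2 := hz1 n
      simp only [hsum]
      rw [div_le_iff₀ (by positivity)]
      linarith
  refine ⟨d, hval, ?_⟩
  rintro ⟨n, hn⟩
  have h1 := piQ_split hq d n
  have h2 : piQ M b (fun i => d (i + n)) = 0 := by
    simp [piQ, fun i => hn (i + n) (by omega)]
  rw [h2, hval, hsum, zero_div, add_zero, eq_div_iff (by positivity)] at h1
  have := hz1 n
  linarith

lemma Phi_spec (hM : 0 < M) {x : ℝ} (hx : x ∈ Set.Ioo (0 : ℝ) 1) :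
    piQ M ((M : ℝ) + 1) (Phi M x ((M : ℝ) + 1)) = x ∧ ¬ EndsInZero (Phi M x ((M : ℝ) + 1)) := by
  obtain ⟨d, hd, hd0⟩ := exists_expansion hM hx
  have h : ∃ d : Digits M, IsQuasiGreedy M ((M : ℝ) + 1) x d :=
    ⟨d, hd, hd0, fun e he he0 => Or.inl (eq_of_piQ_eq_of_not_endsInZero hM (he.trans hd.symm) he0 hd0)⟩
  rw [Phi, dif_pos h]
  exact ⟨h.choose_spec.1, h.choose_spec.2.1⟩

lemma mem_UxSym_of_mem_UqSym {x q : ℝ} {s : Digits M} (hq : q ∈ Set.Ioc (1 : ℝ) ((M : ℝ) + 1))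
    (hs : piQ M q s = x) (hu : s ∈ UqSym M q) (h0 : ¬ EndsInZero s) : s ∈ UxSym M x := by
  have hu' : ∀ e : Digits M, piQ M q e = x → e = s := fun e he => hu e (he.trans hs.symm)
  refine ⟨q, ⟨hq, s, hs, hu'⟩, ?_⟩
  have h : ∃ d : Digits M, IsQuasiGreedy M q x d := ⟨s, hs, h0, fun e he _ => Or.inl (hu' e he)⟩
  rw [Phi, dif_pos h]
  exact hu' _ h.choose_spec.1

lemma continuousOn_piQ {q₀ : ℝ} (hq : 1 < q₀) (s : Digits M) :
    ContinuousOn (fun q => piQ M q s) (Set.Ici q₀) := by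
  have h0 : 0 < q₀ := by linarith
  refine continuousOn_tsum (u := fun i : ℕ => (M : ℝ) / q₀ ^ (i + 1)) (fun i => ?_)
    (hasSum_geometric_digits hq (M : ℝ)).summable (fun i q hq' => ?_)
  · refine continuousOn_const.div (by fun_prop) fun q hq' => ?_
    have : 0 < q := h0.trans_le hq'
    positivity
  · have h2 : q₀ ≤ q := hq'
    have : 0 < q := h0.trans_le hq'
    have h1 := digit_le (s i)
    rw [Real.norm_of_nonneg (by positivity)]
    gcongr

lemma exists_base {b q₀ x : ℝ} (hq₀ : 1 < q₀) (hb : q₀ < b) {s : Digits M} {a : ℕ} (ha : s a ≠ 0)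
    (hlt : piQ M b s < x) (hle : x ≤ piQ M b s + (b - q₀) / b ^ (a + 2)) :
    ∃ q ∈ Set.Ico q₀ b, piQ M q s = x := by
  have h0 : 0 < q₀ := by linarith
  have hb0 : 0 < b := by linarith
  have hdiff : (b - q₀) / b ^ (a + 2) ≤ piQ M q₀ s - piQ M b s := by
    have hS := (summable_digits hq₀ s).sub (summable_digits (hq₀.trans hb) s)
    have hsub : piQ M q₀ s - piQ M b s
        = ∑' i : ℕ, ((s i : ℝ) / q₀ ^ (i + 1) - (s i : ℝ) / b ^ (i + 1)) :=
      ((summable_digits hq₀ s).tsum_sub (summable_digits (hq₀.trans hb) s)).symm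
    have hnn : ∀ i : ℕ, 0 ≤ (s i : ℝ) / q₀ ^ (i + 1) - (s i : ℝ) / b ^ (i + 1) := fun i => by
      rw [sub_nonneg]
      gcongr
    rw [hsub]
    refine le_trans ?_ (hS.le_tsum a fun i _ => hnn i)
    have h1 := one_le_digit ha
    have h2 : 1 / b ^ (a + 1) * (b / q₀) ≤ 1 / q₀ ^ (a + 1) := by
      have h3 : q₀ ^ a ≤ b ^ a := by gcongr
      rw [div_mul_div_comm, one_mul, div_le_div_iff₀ (by positivity) (by positivity),
        pow_succ, pow_succ]
      have : 0 < b * q₀ := by positivity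
      nlinarith
    have h4 : 1 + (b - q₀) / b ≤ b / q₀ := by
      rw [← sub_nonneg]
      have : b / q₀ - (1 + (b - q₀) / b) = (b - q₀) ^ 2 / (b * q₀) := by
        field_simp
        ring
      rw [this]
      positivity
    have h5 : 0 ≤ 1 / q₀ ^ (a + 1) - 1 / b ^ (a + 1) := by
      rw [sub_nonneg]
      gcongr
    calc (b - q₀) / b ^ (a + 2) = 1 / b ^ (a + 1) * (1 + (b - q₀) / b) - 1 / b ^ (a + 1) := by
          rw [show a + 2 = a + 1 + 1 from rfl, pow_succ b (a + 1)]
          field_simp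
          ring
      _ ≤ 1 / b ^ (a + 1) * (b / q₀) - 1 / b ^ (a + 1) := by gcongr
      _ ≤ 1 / q₀ ^ (a + 1) - 1 / b ^ (a + 1) := by gcongr
      _ ≤ (s a : ℝ) * (1 / q₀ ^ (a + 1) - 1 / b ^ (a + 1)) := by nlinarith
      _ = (s a : ℝ) / q₀ ^ (a + 1) - (s a : ℝ) / b ^ (a + 1) := by ring
  have hivt := intermediate_value_Icc' hb.le ((continuousOn_piQ hq₀ s).mono Set.Icc_subset_Ici_self)
  obtain ⟨q, hq, hqx⟩ := hivt ⟨hlt.le, by linarith⟩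
  refine ⟨q, ⟨hq.1, lt_of_le_of_ne hq.2 ?_⟩, hqx⟩
  rintro rfl
  exact hlt.ne hqx

/-- If `ε` expands `x` in base `M + 1` and equals `M` after position `n`, then in a smaller base the
tail of any expansion of `x` agreeing with `ε` up to `n` is less than `1`. -/
lemma tail_lt_one_of_eventually_last (hM : 0 < M) {q : ℝ} (hq : 1 < q) (hqb : q < (M : ℝ) + 1)
    {ε s : Digits M} (h : piQ M q s = piQ M ((M : ℝ) + 1) ε) {n : ℕ}
    (hs : ∀ i ≤ n, s i = ε i) (hn : ∀ i > n, ε i = Fin.last M) :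
    piQ M q (fun i => s (i + (n + 1))) < 1 := by
  have hM' : (0 : ℝ) < M := by exact_mod_cast hM
  have h0 : 0 < q := by linarith
  have htail : piQ M ((M : ℝ) + 1) (fun i => ε (i + (n + 1))) = 1 := by
    have h1 := (hasSum_geometric_digits (hq.trans hqb) (M : ℝ)).tsum_eq
    rw [add_sub_cancel_right, div_self hM'.ne'] at h1
    refine Eq.trans ?_ h1
    unfold piQ
    congr 1
    funext i
    simp only [hn (i + (n + 1)) (by omega), Fin.val_last]
  rw [piQ_split hq s (n + 1), piQ_split (hq.trans hqb) ε (n + 1), htail] at h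
  have h1 : ∑ i ∈ Finset.range (n + 1), (ε i : ℝ) / ((M : ℝ) + 1) ^ (i + 1)
      ≤ ∑ i ∈ Finset.range (n + 1), (s i : ℝ) / q ^ (i + 1) := by
    refine Finset.sum_le_sum fun i hi => ?_
    rw [hs i (Nat.lt_succ_iff.mp (Finset.mem_range.mp hi))]
    gcongr
  have h2 : 1 / ((M : ℝ) + 1) ^ (n + 1) < 1 / q ^ (n + 1) := by
    gcongr
  have h3 : piQ M q (fun i => s (i + (n + 1))) / q ^ (n + 1) < 1 / q ^ (n + 1) := by linarith
  exact (div_lt_div_iff_of_pos_right (by positivity)).mp h3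

lemma concatSeq_eq_left {l : List (Fin (M + 1))} {d : Digits M} {i : ℕ} (h : i < l.length) :
    concatSeq l d i = l[i] := by
  simp [concatSeq, h]

lemma concatSeq_eq_right {l : List (Fin (M + 1))} {d : Digits M} (i : ℕ) :
    concatSeq l d (i + l.length) = d i := by
  simp [concatSeq]

/-- Witnesses, up to a common bound, for the first few tails of a sequence. -/
lemma exists_witness_bound {ε : Digits M} (h0 : ¬ EndsInZero ε) (C : ℕ) :
    ∃ B, ∀ n < C, (∃ t, n < t ∧ t ≤ B ∧ ε t ≠ 0) ∧
      ((∀ t > n, ε t = Fin.last M) ∨ ∃ t, n < t ∧ t ≤ B ∧ ε t ≠ Fin.last M) := by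
  have h : ∀ n, ∃ B, (∃ t, n < t ∧ t ≤ B ∧ ε t ≠ 0) ∧
      ((∀ t > n, ε t = Fin.last M) ∨ ∃ t, n < t ∧ t ≤ B ∧ ε t ≠ Fin.last M) := by
    intro n
    simp only [EndsInZero, not_exists, not_forall] at h0
    obtain ⟨t, ht, htn⟩ := h0 (n + 1)
    by_cases hl : ∀ t > n, ε t = Fin.last M
    · exact ⟨t, ⟨t, ht, le_rfl, htn⟩, Or.inl hl⟩
    · push Not at hl
      obtain ⟨u, hu, hun⟩ := hl
      exact ⟨max t u, ⟨t, ht, le_max_left _ _, htn⟩, Or.inr ⟨u, hu, le_max_right _ _, hun⟩⟩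
  choose B hB using h
  refine ⟨∑ n ∈ Finset.range C, B n, fun n hn => ?_⟩
  have hle : B n ≤ ∑ n ∈ Finset.range C, B n :=
    Finset.single_le_sum (f := B) (fun _ _ => Nat.zero_le _) (Finset.mem_range.mpr hn)
  obtain ⟨⟨t, h1, h2, h3⟩, h4⟩ := hB n
  refine ⟨⟨t, h1, h2.trans hle, h3⟩, h4.imp id ?_⟩
  rintro ⟨u, h5, h6, h7⟩
  exact ⟨u, h5, h6.trans hle, h7⟩

/-- A number `x` with expansion `ε` in base `M + 1`, cut at a position `p` carrying a nonzero digit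
and continued by a digit `0`, is expanded by the resulting sequence in a base close to `M + 1`. -/
lemma exists_base_of_cut (hM : 0 < M) {ε s : Digits M} (h0 : ¬ EndsInZero ε) {a n : ℕ}
    (ha : ε a ≠ 0) (hs : ∀ i < a + 5 + n, s i = ε i) (hp : ε (a + 5 + n) ≠ 0)
    (hsp : s (a + 5 + n) = 0) :
    ∃ q ∈ Set.Ioo (1 : ℝ) ((M : ℝ) + 1), piQ M q s = piQ M ((M : ℝ) + 1) ε ∧
      (M : ℝ) / (q - 1) - 1 < 1 / q ^ (n + 1) := by
  have hM' : (1 : ℝ) ≤ M := by exact_mod_cast hM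
  have hM0 : (M : ℝ) ≠ 0 := by positivity
  set b : ℝ := (M : ℝ) + 1 with hb
  have hb1 : 1 < b := by linarith
  have hb2 : 2 ≤ b := by linarith
  have hb0 : 0 < b := by linarith
  have hMb : (M : ℝ) / (b - 1) = 1 := by rw [hb, add_sub_cancel_right, div_self hM0]
  obtain ⟨p, hpdef⟩ : ∃ p, p = a + 5 + n := ⟨_, rfl⟩
  rw [← hpdef] at hs hp hsp
  have hsum : ∑ i ∈ Finset.range p, (s i : ℝ) / b ^ (i + 1)
      = ∑ i ∈ Finset.range p, (ε i : ℝ) / b ^ (i + 1) :=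
    Finset.sum_congr rfl fun i hi => by rw [hs i (Finset.mem_range.mp hi)]
  have hlt : piQ M b s < piQ M b ε := by
    rw [piQ_split hb1 s (p + 1), piQ_split hb1 ε (p + 1), Finset.sum_range_succ,
      Finset.sum_range_succ, hsum, hsp, add_assoc, add_assoc, ← add_div, ← add_div]
    have h1 := piQ_le hb1 (fun i => s (i + (p + 1)))
    have h2 := one_le_digit hp
    have h3 : 0 < piQ M b (fun i => ε (i + (p + 1))) := by
      simp only [EndsInZero, not_exists, not_forall] at h0
      obtain ⟨t, ht, htd⟩ := h0 (p + 1)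
      refine lt_of_lt_of_le ?_ (le_piQ_of_ne_zero hb1 (d := fun i => ε (i + (p + 1)))
        (t := t - (p + 1)) (by rwa [Nat.sub_add_cancel ht]))
      positivity
    rw [hMb] at h1
    have h4 : (((0 : Fin (M + 1)) : ℕ) : ℝ) = 0 := by simp
    have h5 : 0 < b ^ (p + 1) := by positivity
    rw [h4, add_lt_add_iff_left, div_lt_div_iff_of_pos_right h5]
    linarith
  have hle : piQ M b ε ≤ piQ M b s + 1 / b ^ p := by
    rw [piQ_split hb1 s p, piQ_split hb1 ε p, hsum, add_assoc, ← add_div]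
    have h1 := piQ_le hb1 (fun i => ε (i + p))
    have h2 := piQ_nonneg hb1 (fun i => s (i + p))
    rw [hMb] at h1
    gcongr
    linarith
  set δ : ℝ := 1 / b ^ (n + 3) with hδ
  have hδ0 : 0 < δ := by positivity
  have hδ1 : δ ≤ 1 / 2 := by
    rw [hδ]
    refine one_div_le_one_div_of_le (by norm_num) (hb2.trans ?_)
    exact le_self_pow₀ hb1.le (by omega)
  obtain ⟨q, ⟨hq1, hq2⟩, hqx⟩ := exists_base (b := b) (q₀ := b - δ) (x := piQ M b ε) (s := s)
    (a := a) (by linarith) (by linarith) (by rwa [hs a (by omega)]) hlt (by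
      refine hle.trans (le_of_eq ?_)
      rw [sub_sub_cancel, hδ, div_div, ← pow_add, hpdef]
      congr 3
      ring)
  have hq : 1 < q := by linarith
  have hq0 : 0 < q := by linarith
  refine ⟨q, ⟨hq, hq2⟩, hqx, ?_⟩
  have e1 : (M : ℝ) / (q - 1) - 1 = (b - q) / (q - 1) := by
    have : q - 1 ≠ 0 := by linarith
    field_simp
    rw [hb]
    ring
  calc (M : ℝ) / (q - 1) - 1 = (b - q) / (q - 1) := e1
    _ ≤ δ / (1 / 2) := by gcongr <;> linarith
    _ = 2 * (1 / b ^ (n + 3)) := by rw [hδ]; ring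
    _ ≤ b * (1 / b ^ (n + 3)) := by gcongr
    _ = 1 / b ^ (n + 2) := by
      rw [show n + 3 = n + 2 + 1 from rfl, pow_succ b (n + 2)]
      field_simp
    _ < 1 / b ^ (n + 1) := by
      gcongr
      omega
    _ ≤ 1 / q ^ (n + 1) := by gcongr

/-- The sequence obtained by cutting `ε` at a nonzero digit and continuing with `0`, `1` and a
sequence `d` without long runs is univoque in a suitable base. -/
lemma mem_UxSym_of_cut (hM : 0 < M) {ε s d : Digits M} (h0 : ¬ EndsInZero ε) {a n B : ℕ}
    (ha : ε a ≠ 0)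
    (hB : ∀ m < a + 5, (∃ t, m < t ∧ t ≤ B ∧ ε t ≠ 0) ∧
      ((∀ t > m, ε t = Fin.last M) ∨ ∃ t, m < t ∧ t ≤ B ∧ ε t ≠ Fin.last M))
    (hn : B ≤ n) (hs : ∀ i < a + 5 + n, s i = ε i) (hp : ε (a + 5 + n) ≠ 0)
    (hs0 : s (a + 5 + n) = 0) (hs1 : s (a + 5 + n + 1) = 1)
    (hsd : ∀ i, s (i + (a + 5 + n + 2)) = d i)
    (hd : ∀ m : ℕ, ¬ (∀ i < n, d (m + i) = 0) ∧ ¬ (∀ i < n, d (m + i) = Fin.last M)) :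
    s ∈ UxSym M (piQ M ((M : ℝ) + 1) ε) := by
  obtain ⟨q, ⟨hq1, hqb⟩, hqx, hK⟩ := exists_base_of_cut hM h0 ha hs hp hs0
  have h10 : (1 : Fin (M + 1)) ≠ 0 := by
    have : NeZero M := ⟨hM.ne'⟩
    exact one_ne_zero
  have h0l : (0 : Fin (M + 1)) ≠ Fin.last M := by
    intro h
    have := congrArg Fin.val h
    simp at this
    omega
  refine mem_UxSym_of_mem_UqSym ⟨hq1, hqb.le⟩ hqx
    (mem_UqSym_of_short_runs hq1 hK (fun m hm => ?_) (fun m hm => ?_)) ?_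
  · rcases lt_or_ge m (a + 5) with hma | hma
    · rcases (hB m hma).2 with hl | ⟨t, ht1, ht2, ht3⟩
      · exact Or.inl (tail_lt_one_of_eventually_last hM hq1 hqb hqx
          (fun i hi => hs i (by omega)) hl)
      · refine Or.inr ⟨t - (m + 1), by omega, ?_⟩
        rw [Nat.sub_add_cancel (by omega), hs t (by omega)]
        exact ht3
    · rcases lt_or_ge m (a + 5 + n) with hmp | hmp
      · refine Or.inr ⟨a + 5 + n - (m + 1), by omega, ?_⟩
        rw [Nat.sub_add_cancel (by omega), hs0]
        exact h0l
      · obtain ⟨i, hi⟩ := not_forall.mp (hd (m + 1 - (a + 5 + n + 2))).2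
        obtain ⟨hin, hil⟩ := Classical.not_imp.mp hi
        refine Or.inr ⟨m + 1 - (a + 5 + n + 2) + i + (a + 5 + n + 2) - (m + 1), by omega, ?_⟩
        rw [Nat.sub_add_cancel (by omega), hsd]
        exact hil
  · rcases lt_or_ge m (a + 5) with hma | hma
    · obtain ⟨t, ht1, ht2, ht3⟩ := (hB m hma).1
      refine ⟨t - (m + 1), by omega, ?_⟩
      rw [Nat.sub_add_cancel (by omega), hs t (by omega)]
      exact ht3
    · rcases le_or_gt m (a + 5 + n) with hmp | hmp
      · refine ⟨a + 5 + n + 1 - (m + 1), by omega, ?_⟩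
        rw [Nat.sub_add_cancel (by omega), hs1]
        exact h10
      · obtain ⟨i, hi⟩ := not_forall.mp (hd (m + 1 - (a + 5 + n + 2))).1
        obtain ⟨hin, hil⟩ := Classical.not_imp.mp hi
        refine ⟨m + 1 - (a + 5 + n + 2) + i + (a + 5 + n + 2) - (m + 1), by omega, ?_⟩
        rw [Nat.sub_add_cancel (by omega), hsd]
        exact hil
  · rintro ⟨m, hm⟩
    refine (hd m).1 fun i _ => ?_
    rw [← hsd]
    exact hm _ (by omega)

end UnivoqueBases

/-- Lemma: for `x ∈ (0,1)` with quasi-greedy expansion `(ε_i) = Φ_x(M+1)` in base `M+1`,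
there are a word `w`, a positive integer `N` and a strictly increasing sequence `(N_j)` of
positive integers such that for every `j` and every sequence `(d_i)` containing no block
of `N_j` consecutive `0`'s and no block of `N_j` consecutive `M`'s, the sequence
`ε₁…ε_{N+N_j} w d₁d₂…` belongs to `𝐔(x)`. -/
theorem mem_UxSym_of_no_long_runs (M : ℕ) (hM : 0 < M) (x : ℝ)
    (hx : x ∈ Set.Ioo (0 : ℝ) 1) :
    ∃ (w : List (Fin (M + 1))) (N : ℕ) (Nj : ℕ → ℕ),
      0 < N ∧ StrictMono Nj ∧ (∀ j, 0 < Nj j) ∧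
      ∀ j, ∀ d : Digits M,
        (∀ n : ℕ, ¬ (∀ i < Nj j, d (n + i) = 0) ∧ ¬ (∀ i < Nj j, d (n + i) = Fin.last M)) →
        concatSeq (List.ofFn (fun i : Fin (N + Nj j) => Phi M x ((M : ℝ) + 1) i) ++ w) d
          ∈ UxSym M x := by
  obtain ⟨hval, h0⟩ := Phi_spec hM hx
  set ε : Digits M := Phi M x ((M : ℝ) + 1) with hε
  have h0' := h0
  simp only [EndsInZero, not_exists, not_forall] at h0'
  obtain ⟨a, -, ha⟩ := h0' 0
  obtain ⟨B, hB⟩ := exists_witness_bound h0 (a + 5)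
  have hfreq : ∃ᶠ n in Filter.atTop, ε (a + 5 + n) ≠ 0 ∧ B + 1 ≤ n := by
    rw [Filter.frequently_atTop]
    intro m
    obtain ⟨t, ht, htn⟩ := h0' (a + 5 + (m + (B + 1)))
    refine ⟨t - (a + 5), by omega, ?_, by omega⟩
    rwa [Nat.add_sub_cancel' (by omega)]
  obtain ⟨Nj, hmono, hNj⟩ := Filter.extraction_of_frequently_atTop hfreq
  refine ⟨[0, 1], a + 5, Nj, by omega, hmono, fun j => by have := (hNj j).2; omega,
    fun j d hd => ?_⟩
  rw [← hval]
  refine mem_UxSym_of_cut hM h0 (d := d) (n := Nj j) ha hB (by have := (hNj j).2; omega)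
    (fun i hi => ?_) (hNj j).1 ?_ ?_ (fun i => ?_) hd
  · rw [concatSeq_eq_left (by simp; omega), List.getElem_append_left (by simpa using hi)]
    simp
  · rw [concatSeq_eq_left (by simp), List.getElem_append_right (by simp)]
    simp
  · rw [concatSeq_eq_left (by simp), List.getElem_append_right (by simp)]
    simp
  · have := concatSeq_eq_right (d := d)
      (l := List.ofFn (fun i : Fin (a + 5 + Nj j) => ε i) ++ [0, 1]) i
    simpa using this

end Expansions
end
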